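/- arXiv:1909.13477 — 4 statements merged into one kernel-verified Lean document; each statement's English description precedes it below -/
import Mathlib

section
/- Let L be a distribution function on ℝ with ∫x dL(x) = 0 and ∫x² dL(x) = 1, let 0 < β < 1, and suppose a random variable ξ with distribution L satisfies E e^{tξ} ≤ e^{t²/(2b)} for all t ∈ ℝ, for some constant b > β. Let (X₁, …, Xₙ) have the Curie–Weiss joint distribution dP_{n,β}(x) = K_n^{-1} exp(β(x₁+⋯+xₙ)²/(2n)) Π_{i=1}^n dL(x_i) with K_n the normalizing constant, and set Wₙ = (X₁+⋯+Xₙ)/√n. Then there is a constant C depending only on b and β such that for all z ∈ ℝ: |P(Wₙ ≤ z) − F₁(z)| ≤ C / ((1 + (1−β)|z|)·√n), where F₁ is the distribution function of the normal law N(0, 1/(1−β)). -/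
open MeasureTheory ProbabilityTheory

/-- The Curie–Weiss measure `dP_{n,β}(x) = K_n⁻¹ exp(β(x₁+⋯+xₙ)²/(2n)) Π dL(xᵢ)`,
with `K_n` the normalizing constant. -/
noncomputable def curieWeiss (L : Measure ℝ) [IsProbabilityMeasure L] (n : ℕ) (β : ℝ) :
    Measure (Fin n → ℝ) :=
  let ν : Measure (Fin n → ℝ) :=
    (Measure.pi fun _ : Fin n => L).withDensity
      (fun x => ENNReal.ofReal (Real.exp (β * (∑ i, x i) ^ 2 / (2 * n))))
  (ν Set.univ)⁻¹ • ν

/-- The distribution function of `N(0, 1/(1-β))`. -/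
noncomputable def cdfN (β z : ℝ) : ℝ :=
  ∫ x in Set.Iic z, Real.sqrt ((1 - β) / (2 * Real.pi)) * Real.exp (-((1 - β) * x ^ 2) / 2)

/-- The exponential square weight `exp (s w² / 2)`. -/
noncomputable def expSq (s w : ℝ) : ℝ := Real.exp (s * w ^ 2 / 2)

lemma expSq_pos (s w : ℝ) : 0 < expSq s w := Real.exp_pos _

lemma one_le_expSq {s : ℝ} (hs : 0 ≤ s) (w : ℝ) : 1 ≤ expSq s w :=
  Real.one_le_exp (by positivity)

lemma continuous_expSq (s : ℝ) : Continuous (expSq s) := by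
  unfold expSq; fun_prop

lemma measurable_expSq (s : ℝ) : Measurable (expSq s) := (continuous_expSq s).measurable

lemma hasDerivAt_expSq (s w : ℝ) : HasDerivAt (expSq s) (s * w * expSq s w) w := by
  have h : HasDerivAt (fun w : ℝ => s * w ^ 2 / 2) (s * w) w := by
    refine (((hasDerivAt_pow 2 w).const_mul s).div_const 2).congr_deriv ?_
    push_cast
    ring
  have := h.exp
  unfold expSq
  convert this using 1
  ring

lemma one_add_pow_le_exp (k : ℕ) :
    ∃ C : ℝ, 0 < C ∧ ∀ x : ℝ, (1 + |x|) ^ k ≤ C * Real.exp |x| := by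
  refine ⟨k.factorial * Real.exp 1, by positivity, fun x => ?_⟩
  have h := Real.pow_div_factorial_le_exp (1 + |x|) (by positivity) k
  rw [div_le_iff₀ (by positivity), Real.exp_add] at h
  linarith

/-- Polynomial factors are absorbed by a larger exponent. -/
lemma pow_mul_expSq_le {s s' : ℝ} (h : s < s') (k : ℕ) :
    ∃ C : ℝ, 0 < C ∧ ∀ w : ℝ, (1 + |w|) ^ k * expSq s w ≤ C * expSq s' w := by
  obtain ⟨C, hC, hk⟩ := one_add_pow_le_exp k
  refine ⟨C * Real.exp (1 / (2 * (s' - s))), by positivity, fun w => ?_⟩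
  have hd : 0 < s' - s := sub_pos.2 h
  have h1 : |w| ≤ 1 / (2 * (s' - s)) + (s' - s) * w ^ 2 / 2 := by
    have : 1 / (2 * (s' - s)) + (s' - s) * w ^ 2 / 2 - |w|
        = ((s' - s) * |w| - 1) ^ 2 / (2 * (s' - s)) := by
      rw [← sq_abs w]; field_simp; ring
    have h2 : 0 ≤ ((s' - s) * |w| - 1) ^ 2 / (2 * (s' - s)) := by positivity
    linarith
  calc (1 + |w|) ^ k * expSq s w ≤ C * Real.exp |w| * expSq s w := by
        gcongr
        · exact (expSq_pos s w).le
        · exact hk w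
    _ ≤ C * Real.exp (1 / (2 * (s' - s)) + (s' - s) * w ^ 2 / 2) * expSq s w := by
        gcongr
        exact (expSq_pos s w).le
    _ = C * Real.exp (1 / (2 * (s' - s))) * expSq s' w := by
        unfold expSq
        rw [mul_assoc, mul_assoc, ← Real.exp_add, ← Real.exp_add]
        congr 2
        ring

/-- Powers of a second variable are absorbed at the price of an exponential of it. -/
lemma pow_mul_expSq_le_exp_add {s s' : ℝ} (h : s < s') (k : ℕ) :
    ∃ C : ℝ, 0 < C ∧
      ∀ x w : ℝ, (1 + |x|) ^ k * expSq s w ≤ C * (Real.exp |x| + expSq s' w) := by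
  have hd : 0 < s' - s := sub_pos.2 h
  obtain ⟨m, hm⟩ := exists_nat_ge (s / (s' - s))
  rw [div_le_iff₀ hd] at hm
  obtain ⟨C, hC, hk⟩ := one_add_pow_le_exp (k + k * m)
  refine ⟨C + 1, by positivity, fun x w => ?_⟩
  have e1 := Real.exp_pos |x|
  have e2 := expSq_pos s' w
  have hsplit : expSq (s' - s) w * expSq s w = expSq s' w := by
    unfold expSq; rw [← Real.exp_add]; congr 1; ring
  rcases le_total ((1 + |x|) ^ k) (expSq (s' - s) w) with hc | hc
  · have : (1 + |x|) ^ k * expSq s w ≤ expSq s' w := by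
      rw [← hsplit]; gcongr; exact (expSq_pos s w).le
    nlinarith
  · have h1 : expSq s w ≤ expSq (s' - s) w ^ m := by
      unfold expSq
      rw [← Real.exp_nat_mul]
      apply Real.exp_le_exp.2
      nlinarith [sq_nonneg w]
    have : (1 + |x|) ^ k * expSq s w ≤ C * Real.exp |x| := by
      calc (1 + |x|) ^ k * expSq s w ≤ (1 + |x|) ^ k * ((1 + |x|) ^ k) ^ m := by
            gcongr
            exact h1.trans (pow_le_pow_left₀ (expSq_pos _ _).le hc m)
        _ = (1 + |x|) ^ (k + k * m) := by rw [← pow_mul, ← pow_add]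
        _ ≤ _ := hk x
    nlinarith

lemma lintegral_expSq_gaussian_lt_top {c : ℝ} (hc : c < 1) :
    ∫⁻ z, ENNReal.ofReal (expSq c z) ∂(gaussianReal 0 1) < ⊤ := by
  rw [gaussianReal_of_var_ne_zero 0 one_ne_zero,
    lintegral_withDensity_eq_lintegral_mul _ (measurable_gaussianPDF 0 1)
      (measurable_expSq c).ennreal_ofReal]
  have hi : Integrable (fun z : ℝ => (Real.sqrt (2 * Real.pi))⁻¹ *
      Real.exp (-((1 - c) / 2) * z ^ 2)) :=
    (integrable_exp_neg_mul_sq (by linarith)).const_mul _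
  have h2 := hi.lintegral_lt_top
  refine lt_of_le_of_lt (le_of_eq ?_) h2
  refine lintegral_congr fun z => ?_
  simp only [Pi.mul_apply, gaussianPDF, gaussianPDFReal, NNReal.coe_one, mul_one, sub_zero]
  rw [← ENNReal.ofReal_mul (by positivity), mul_assoc, expSq, ← Real.exp_add]
  congr 3
  ring

/-- A sub-Gaussian moment generating function bounds exponential square moments, by writing
`exp (s x² / 2)` as a Gaussian mixture of exponentials. -/
lemma lintegral_expSq_le {b s : ℝ} (hs : 0 ≤ s) (ν : Measure ℝ) [SFinite ν]
    (hν : ∀ t : ℝ, ∫⁻ x, ENNReal.ofReal (Real.exp (t * x)) ∂ν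
      ≤ ENNReal.ofReal (Real.exp (t ^ 2 / (2 * b)))) :
    ∫⁻ x, ENNReal.ofReal (expSq s x) ∂ν
      ≤ ∫⁻ z, ENNReal.ofReal (expSq (s / b) z) ∂(gaussianReal 0 1) := by
  have key : ∀ x : ℝ, ENNReal.ofReal (expSq s x)
      = ∫⁻ z, ENNReal.ofReal (Real.exp (Real.sqrt s * z * x)) ∂(gaussianReal 0 1) := by
    intro x
    have h1 := congrFun (mgf_id_gaussianReal (μ := 0) (v := 1)) (Real.sqrt s * x)
    have h2 := integrable_exp_mul_gaussianReal (μ := 0) (v := 1) (Real.sqrt s * x)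
    rw [show (fun z => ENNReal.ofReal (Real.exp (Real.sqrt s * z * x)))
      = fun z => ENNReal.ofReal (Real.exp (Real.sqrt s * x * z)) from by
        ext z; congr 2; ring]
    rw [← ofReal_integral_eq_lintegral_ofReal h2 (ae_of_all _ fun _ => (Real.exp_pos _).le)]
    congr 1
    simp only [mgf, id] at h1
    rw [h1, expSq]
    congr 1
    rw [mul_pow, Real.sq_sqrt hs]
    simp
  calc ∫⁻ x, ENNReal.ofReal (expSq s x) ∂ν
      = ∫⁻ x, ∫⁻ z, ENNReal.ofReal (Real.exp (Real.sqrt s * z * x)) ∂(gaussianReal 0 1) ∂ν :=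
        lintegral_congr key
    _ = ∫⁻ z, ∫⁻ x, ENNReal.ofReal (Real.exp (Real.sqrt s * z * x)) ∂ν ∂(gaussianReal 0 1) := by
        apply lintegral_lintegral_swap
        apply Measurable.aemeasurable
        unfold Function.uncurry
        fun_prop
    _ ≤ ∫⁻ z, ENNReal.ofReal (expSq (s / b) z) ∂(gaussianReal 0 1) := by
        refine lintegral_mono fun z => (hν _).trans (le_of_eq ?_)
        rw [expSq, mul_pow, Real.sq_sqrt hs]
        congr 2
        ring
/-- The density of `N(0, 1/(1-β))`. -/
noncomputable def densN (β x : ℝ) : ℝ :=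
  Real.sqrt ((1 - β) / (2 * Real.pi)) * Real.exp (-((1 - β) * x ^ 2) / 2)

lemma densN_nonneg (β x : ℝ) : 0 ≤ densN β x := by unfold densN; positivity

lemma continuous_densN (β : ℝ) : Continuous (densN β) := by unfold densN; fun_prop

lemma densN_eq_exp (β : ℝ) :
    densN β = fun x => Real.sqrt ((1 - β) / (2 * Real.pi)) *
      Real.exp (-((1 - β) / 2) * x ^ 2) := by
  ext x; unfold densN; congr 2; ring

lemma integrable_densN {β : ℝ} (hβ : β < 1) : Integrable (densN β) := by
  rw [densN_eq_exp]
  exact (integrable_exp_neg_mul_sq (by linarith)).const_mul _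

lemma integral_densN {β : ℝ} (hβ : β < 1) : ∫ x, densN β x = 1 := by
  have h : 0 < 1 - β := by linarith
  rw [densN_eq_exp, integral_const_mul, integral_gaussian, ← Real.sqrt_mul (by positivity)]
  rw [show (1 - β) / (2 * Real.pi) * (Real.pi / ((1 - β) / 2)) = 1 by field_simp]
  exact Real.sqrt_one

lemma cdfN_eq (β z : ℝ) : cdfN β z = ∫ x in Set.Iic z, densN β x := rfl

lemma cdfN_nonneg (β z : ℝ) : 0 ≤ cdfN β z :=
  integral_nonneg fun x => densN_nonneg β x

lemma one_sub_cdfN {β : ℝ} (hβ : β < 1) (z : ℝ) :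
    1 - cdfN β z = ∫ x in Set.Ioi z, densN β x := by
  rw [← integral_densN hβ, cdfN_eq,
    ← intervalIntegral.integral_Iic_add_Ioi (integrable_densN hβ).integrableOn
      (integrable_densN hβ).integrableOn (b := z)]
  ring

lemma cdfN_le_one {β : ℝ} (hβ : β < 1) (z : ℝ) : cdfN β z ≤ 1 := by
  have h : 0 ≤ 1 - cdfN β z := by
    rw [one_sub_cdfN hβ]
    exact integral_nonneg fun x => densN_nonneg β x
  linarith

lemma cdfN_neg {β : ℝ} (hβ : β < 1) (z : ℝ) : cdfN β (-z) = 1 - cdfN β z := by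
  have h := integral_comp_neg_Iic (-z) (densN β)
  rw [neg_neg] at h
  rw [one_sub_cdfN hβ, cdfN_eq, ← h]
  simp [densN]

lemma cdfN_sub_cdfN {β : ℝ} (hβ : β < 1) (a b : ℝ) :
    cdfN β b - cdfN β a = ∫ x in a..b, densN β x :=
  intervalIntegral.integral_Iic_sub_Iic (integrable_densN hβ).integrableOn
    (integrable_densN hβ).integrableOn

lemma hasDerivAt_cdfN {β : ℝ} (hβ : β < 1) (w : ℝ) :
    HasDerivAt (cdfN β) (densN β w) w := by
  have h : cdfN β = fun w => (∫ x in (0 : ℝ)..w, densN β x) + cdfN β 0 := by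
    ext w; rw [← cdfN_sub_cdfN hβ]; ring
  rw [h]
  exact ((continuous_densN β).integral_hasStrictDerivAt 0 w).hasDerivAt.add_const _

lemma continuous_cdfN {β : ℝ} (hβ : β < 1) : Continuous (cdfN β) :=
  continuous_iff_continuousAt.2 fun w => (hasDerivAt_cdfN hβ w).continuousAt

/-- Mills' bound for the Gaussian tail. -/
lemma one_sub_cdfN_le {β : ℝ} (hβ : β < 1) :
    ∃ C : ℝ, 0 < C ∧ ∀ w : ℝ, 0 ≤ w →
      (1 + w) * ((1 - cdfN β w) * expSq (1 - β) w) ≤ C := by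
  have h : 0 < 1 - β := by linarith
  refine ⟨Real.sqrt ((1 - β) / (2 * Real.pi)) * Real.exp ((1 - β) / 2) / (1 - β),
    by positivity, fun w hw => ?_⟩
  have hneg : -((1 - β) * (1 + w)) < 0 := by
    have : 0 < (1 - β) * (1 + w) := by positivity
    linarith
  set D : ℝ := Real.sqrt ((1 - β) / (2 * Real.pi)) *
    Real.exp ((1 - β) / 2 - (1 - β) * w ^ 2 / 2 + (1 - β) * (1 + w) * w) with hD
  have hle : ∀ x, densN β x ≤ D * Real.exp (-((1 - β) * (1 + w)) * x) := by
    intro x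
    rw [hD, densN, mul_assoc, ← Real.exp_add]
    gcongr
    nlinarith [mul_nonneg h.le (sq_nonneg (x - w - 1))]
  have h_int : IntegrableOn (fun x => D * Real.exp (-((1 - β) * (1 + w)) * x)) (Set.Ioi w) :=
    (integrableOn_exp_mul_Ioi hneg w).const_mul _
  have h1 : 1 - cdfN β w ≤ D * (Real.exp (-((1 - β) * (1 + w)) * w) / ((1 - β) * (1 + w))) := by
    rw [one_sub_cdfN hβ]
    refine (setIntegral_mono (integrable_densN hβ).integrableOn h_int hle).trans (le_of_eq ?_)
    rw [integral_const_mul, integral_exp_mul_Ioi hneg]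
    congr 1
    rw [neg_div_neg_eq]
  calc (1 + w) * ((1 - cdfN β w) * expSq (1 - β) w)
      ≤ (1 + w) * (D * (Real.exp (-((1 - β) * (1 + w)) * w) / ((1 - β) * (1 + w)))
          * expSq (1 - β) w) := by
        gcongr
        exact (expSq_pos _ _).le
    _ = Real.sqrt ((1 - β) / (2 * Real.pi)) * (Real.exp ((1 - β) / 2 - (1 - β) * w ^ 2 / 2
          + (1 - β) * (1 + w) * w) * Real.exp (-((1 - β) * (1 + w)) * w)
          * expSq (1 - β) w) / (1 - β) := by
        rw [hD]; field_simp
    _ = _ := by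
        rw [expSq, ← Real.exp_add, ← Real.exp_add]
        congr 3
        ring_nf

/-- The centred half-line indicator. -/
noncomputable def centredInd (β z w : ℝ) : ℝ := (if w ≤ z then 1 else 0) - cdfN β z

lemma measurable_centredInd (β z : ℝ) : Measurable (centredInd β z) := by
  unfold centredInd
  exact (Measurable.ite measurableSet_Iic measurable_const measurable_const).sub_const _

lemma one_add_mul_one_sub_cdfN_le {β : ℝ} (hβ : β < 1) :
    ∃ C : ℝ, 0 < C ∧ ∀ w : ℝ, 0 ≤ w → (1 + w) * (1 - cdfN β w) ≤ C := by
  obtain ⟨C, hC, h⟩ := one_sub_cdfN_le hβ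
  refine ⟨C, hC, fun w hw => le_trans ?_ (h w hw)⟩
  have h1 := one_le_expSq (sub_pos.2 hβ).le w
  have h2 := cdfN_le_one hβ w
  gcongr
  nlinarith

lemma abs_centredInd_le {β : ℝ} (hβ : β < 1) :
    ∃ C : ℝ, 0 < C ∧ ∀ z w : ℝ, (1 + |z|) * |centredInd β z w| ≤ C * (1 + |w|) := by
  obtain ⟨C, hC, h⟩ := one_add_mul_one_sub_cdfN_le hβ
  refine ⟨C + 1, by positivity, fun z w => ?_⟩
  have f0 := cdfN_nonneg β z
  have f1 := cdfN_le_one hβ z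
  have hw := abs_nonneg w
  have hz := abs_nonneg z
  have main : (1 + |z|) * |centredInd β z w| ≤ C ∨ (1 + |z|) * |centredInd β z w| ≤ 1 + |w| := by
    unfold centredInd
    split_ifs with hc
    · rw [abs_of_nonneg (show 0 ≤ 1 - cdfN β z by linarith)]
      rcases le_total 0 z with h0 | h0
      · left; rw [abs_of_nonneg h0]; exact h z h0
      · right
        have : |z| ≤ |w| := by rw [abs_of_nonpos h0, abs_of_nonpos (by linarith)]; linarith
        nlinarith
    · rw [zero_sub, abs_neg, abs_of_nonneg f0]
      push Not at hc
      rcases le_total 0 z with h0 | h0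
      · right
        have : |z| ≤ |w| := by rw [abs_of_nonneg h0, abs_of_nonneg (by linarith)]; exact hc.le
        nlinarith
      · left
        have := h (-z) (by linarith)
        rw [cdfN_neg hβ] at this
        rw [abs_of_nonpos h0]; linarith
  rcases main with h | h <;> nlinarith

/-- The solution of Stein's equation `G' - w G = (𝟙_{w ≤ z} - F₁(z)) exp (β w² / 2)`. -/
noncomputable def steinSol (β z w : ℝ) : ℝ :=
  (Real.sqrt ((1 - β) / (2 * Real.pi)))⁻¹ * expSq 1 w *
    (cdfN β (min w z) - cdfN β z * cdfN β w)

lemma continuous_steinSol {β : ℝ} (hβ : β < 1) (z : ℝ) : Continuous (steinSol β z) := by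
  have h1 := continuous_cdfN hβ
  have h2 := continuous_expSq 1
  unfold steinSol
  fun_prop

lemma hasDerivAt_steinSol {β : ℝ} (hβ : β < 1) {z w : ℝ} (hw : w ≠ z) :
    HasDerivAt (steinSol β z)
      (w * steinSol β z w + centredInd β z w * expSq β w) w := by
  have h : 0 < 1 - β := by linarith
  have hdens : (Real.sqrt ((1 - β) / (2 * Real.pi)))⁻¹ * expSq 1 w * densN β w = expSq β w := by
    have : Real.sqrt ((1 - β) / (2 * Real.pi)) ≠ 0 := by positivity
    rw [densN]
    field_simp
    rw [expSq, expSq, ← Real.exp_add]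
    congr 1; ring
  have hmin : HasDerivAt (fun w => cdfN β (min w z))
      ((if w ≤ z then 1 else 0) * densN β w) w := by
    rcases lt_or_gt_of_ne hw with hlt | hgt
    · rw [if_pos hlt.le, one_mul]
      refine (hasDerivAt_cdfN hβ w).congr_of_eventuallyEq ?_
      filter_upwards [Iio_mem_nhds hlt] with x hx
      rw [min_eq_left (le_of_lt hx)]
    · rw [if_neg (not_le.2 hgt), zero_mul]
      refine (hasDerivAt_const w (cdfN β z)).congr_of_eventuallyEq ?_
      filter_upwards [Ioi_mem_nhds hgt] with x hx
      rw [min_eq_right (le_of_lt hx)]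
  have h1 := ((hasDerivAt_expSq 1 w).const_mul
    (Real.sqrt ((1 - β) / (2 * Real.pi)))⁻¹).mul
      (hmin.sub ((hasDerivAt_cdfN hβ w).const_mul (cdfN β z)))
  refine h1.congr_deriv ?_
  unfold steinSol centredInd
  rw [← hdens]
  simp only [Pi.sub_apply]
  ring

lemma expSq_neg (s w : ℝ) : expSq s (-w) = expSq s w := by simp [expSq]

lemma steinSol_neg {β : ℝ} (hβ : β < 1) (z w : ℝ) :
    steinSol β (-z) (-w) = steinSol β z w := by
  unfold steinSol
  rw [expSq_neg, cdfN_neg hβ, cdfN_neg hβ]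
  congr 1
  rcases le_total w z with h | h
  · rw [min_eq_left h, min_eq_right (by linarith), cdfN_neg hβ]; ring
  · rw [min_eq_right h, min_eq_left (by linarith), cdfN_neg hβ]; ring

lemma abs_steinSol_le {β : ℝ} (hβ : β < 1) :
    ∃ C : ℝ, 0 < C ∧ ∀ z w : ℝ, (1 + |z|) * |steinSol β z w| ≤ C * expSq β w := by
  obtain ⟨C, hC, h⟩ := one_sub_cdfN_le hβ
  have hγ : 0 < 1 - β := by linarith
  set κ : ℝ := (Real.sqrt ((1 - β) / (2 * Real.pi)))⁻¹ with hκ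
  have hκ0 : 0 < κ := by positivity
  have hsplit : ∀ w, expSq 1 w = expSq β w * expSq (1 - β) w := by
    intro w; unfold expSq; rw [← Real.exp_add]; congr 1; ring
  have h0' : ∀ w, 0 ≤ w → (1 - cdfN β w) * expSq (1 - β) w ≤ C := by
    intro w hw
    refine le_trans ?_ (h w hw)
    have : 0 ≤ (1 - cdfN β w) * expSq (1 - β) w :=
      mul_nonneg (by linarith [cdfN_le_one hβ w]) (expSq_pos _ _).le
    nlinarith
  have hpos : ∀ z w : ℝ, 0 ≤ z →
      (1 + z) * |steinSol β z w| ≤ (κ * (C + C * C)) * expSq β w := by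
    intro z w hz
    have e := expSq_pos β w
    have e' := expSq_pos (1 - β) w
    have z0 := cdfN_nonneg β z
    have z1 := cdfN_le_one hβ z
    have w0 := cdfN_nonneg β w
    have w1 := cdfN_le_one hβ w
    suffices hs : 0 ≤ (cdfN β (min w z) - cdfN β z * cdfN β w) ∧
        (1 + z) * ((cdfN β (min w z) - cdfN β z * cdfN β w) * expSq (1 - β) w) ≤ C + C * C by
      have : 0 ≤ steinSol β z w := by
        unfold steinSol
        exact mul_nonneg (mul_nonneg hκ0.le (expSq_pos _ _).le) hs.1
      rw [abs_of_nonneg this, steinSol, hsplit]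
      calc _ = κ * ((1 + z) * ((cdfN β (min w z) - cdfN β z * cdfN β w) * expSq (1 - β) w))
            * expSq β w := by ring
        _ ≤ _ := by gcongr; exact hs.2
    rcases le_total w z with hwz | hwz
    · rw [min_eq_left hwz]
      have hz1 : (1 + z) * (1 - cdfN β z) ≤ C := by
        refine le_trans ?_ (h z hz)
        gcongr
        nlinarith [one_le_expSq hγ.le z]
      refine ⟨by nlinarith, ?_⟩
      rcases le_total 0 w with hw | hw
      · have : expSq (1 - β) w ≤ expSq (1 - β) z := by unfold expSq; gcongr
        have h3 : (1 + z) * ((1 - cdfN β z) * expSq (1 - β) w) ≤ C :=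
          le_trans (by gcongr) (h z hz)
        calc _ = cdfN β w * ((1 + z) * ((1 - cdfN β z) * expSq (1 - β) w)) := by ring
          _ ≤ 1 * C := by
            gcongr
          _ ≤ _ := by nlinarith
      · have h4 := h0' (-w) (by linarith)
        rw [cdfN_neg hβ, expSq_neg, sub_sub_cancel] at h4
        calc _ = ((1 + z) * (1 - cdfN β z)) * (cdfN β w * expSq (1 - β) w) := by ring
          _ ≤ C * C := by gcongr
          _ ≤ _ := by nlinarith
    · rw [min_eq_right hwz]
      refine ⟨by nlinarith, ?_⟩
      have h5 : (1 + z) * ((1 - cdfN β w) * expSq (1 - β) w) ≤ C := by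
        refine le_trans ?_ (h w (by linarith))
        have : 0 ≤ 1 - cdfN β w := by linarith
        gcongr
      calc _ = cdfN β z * ((1 + z) * ((1 - cdfN β w) * expSq (1 - β) w)) := by ring
        _ ≤ 1 * C := by
          gcongr
        _ ≤ _ := by nlinarith
  refine ⟨κ * (C + C * C), by positivity, fun z w => ?_⟩
  rcases le_total 0 z with hz | hz
  · rw [abs_of_nonneg hz]; exact hpos z w hz
  · have := hpos (-z) (-w) (by linarith)
    rw [steinSol_neg hβ, expSq_neg] at this
    rw [abs_of_nonpos hz]; exact this
/-- The right-hand side of Stein's equation, solved for the derivative. -/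
noncomputable def steinDeriv (β z w : ℝ) : ℝ :=
  w * steinSol β z w + centredInd β z w * expSq β w

lemma measurable_steinDeriv {β : ℝ} (hβ : β < 1) (z : ℝ) : Measurable (steinDeriv β z) :=
  (measurable_id.mul (continuous_steinSol hβ z).measurable).add
    ((measurable_centredInd β z).mul (measurable_expSq β))

lemma abs_sub_le_of_hasDerivAt_Ioo {f f' : ℝ → ℝ} {a b M : ℝ} (hab : a ≤ b)
    (hf : Continuous f) (hd : ∀ x ∈ Set.Ioo a b, HasDerivAt f (f' x) x)
    (hM : ∀ x ∈ Set.Ioo a b, |f' x| ≤ M) : |f b - f a| ≤ M * (b - a) := by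
  rcases hab.eq_or_lt with rfl | hlt
  · simp
  · obtain ⟨c, hc, h⟩ := exists_hasDerivAt_eq_slope f f' hlt hf.continuousOn hd
    have hba : 0 < b - a := sub_pos.2 hlt
    rw [eq_div_iff hba.ne'] at h
    rw [← h, abs_mul, abs_of_pos hba]
    exact mul_le_mul_of_nonneg_right (hM c hc) hba.le

lemma abs_sub_le_of_hasDerivAt_ne_Icc {f f' : ℝ → ℝ} {a b M z : ℝ} (hab : a ≤ b)
    (hf : Continuous f) (hd : ∀ x, x ≠ z → HasDerivAt f (f' x) x)
    (hM : ∀ x ∈ Set.Icc a b, |f' x| ≤ M) : |f b - f a| ≤ M * (b - a) := by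
  by_cases hz : z ∈ Set.Ioo a b
  · have h1 := abs_sub_le_of_hasDerivAt_Ioo hz.1.le hf (fun x hx => hd x hx.2.ne)
      (fun x hx => hM x ⟨hx.1.le, hx.2.le.trans hz.2.le⟩)
    have h2 := abs_sub_le_of_hasDerivAt_Ioo hz.2.le hf (fun x hx => hd x hx.1.ne')
      (fun x hx => hM x ⟨hz.1.le.trans hx.1.le, hx.2.le⟩)
    calc |f b - f a| = |(f b - f z) + (f z - f a)| := by ring_nf
      _ ≤ |f b - f z| + |f z - f a| := abs_add_le _ _
      _ ≤ M * (b - z) + M * (z - a) := add_le_add h2 h1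
      _ = M * (b - a) := by ring
  · refine abs_sub_le_of_hasDerivAt_Ioo hab hf (fun x hx => hd x ?_)
      (fun x hx => hM x ⟨hx.1.le, hx.2.le⟩)
    rintro rfl
    exact hz hx

/-- The mean value inequality for a function differentiable away from one point. -/
lemma abs_sub_le_of_hasDerivAt_ne {f f' : ℝ → ℝ} {a b M z : ℝ}
    (hf : Continuous f) (hd : ∀ x, x ≠ z → HasDerivAt f (f' x) x)
    (hM : ∀ x ∈ Set.uIcc a b, |f' x| ≤ M) : |f b - f a| ≤ M * |b - a| := by
  rcases le_total a b with h | h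
  · rw [abs_of_nonneg (sub_nonneg.2 h)]
    rw [Set.uIcc_of_le h] at hM
    exact abs_sub_le_of_hasDerivAt_ne_Icc h hf hd hM
  · rw [abs_sub_comm (f b), abs_sub_comm b, abs_of_nonneg (sub_nonneg.2 h)]
    rw [Set.uIcc_of_ge h] at hM
    exact abs_sub_le_of_hasDerivAt_ne_Icc h hf hd hM

lemma exists_endpoint_abs_le (w v : ℝ) :
    ∃ e, (e = w ∨ e = v) ∧ ∀ y ∈ Set.uIcc w v, |y| ≤ |e| := by
  have key : ∀ y ∈ Set.uIcc w v, |y| ≤ max |w| |v| := by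
    intro y hy
    rcases Set.mem_uIcc.1 hy with h | h
    · exact abs_le_max_abs_abs h.1 h.2
    · rw [max_comm]; exact abs_le_max_abs_abs h.1 h.2
  rcases max_choice |w| |v| with h | h <;> rw [h] at key
  · exact ⟨w, Or.inl rfl, key⟩
  · exact ⟨v, Or.inr rfl, key⟩

lemma expSq_le_of_abs_le {s y e : ℝ} (hs : 0 ≤ s) (h : |y| ≤ |e|) : expSq s y ≤ expSq s e := by
  have := sq_le_sq.2 h
  unfold expSq
  gcongr

/-- Increments of a polynomially weighted `expSq` along a segment are controlled at the
endpoints by a larger exponent. -/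
lemma segment_pow_mul_expSq_le {s s' : ℝ} (hs : 0 ≤ s) (h : s < s') (k : ℕ) :
    ∃ C : ℝ, 0 < C ∧ ∀ w v y y' : ℝ, y ∈ Set.uIcc w v → y' ∈ Set.uIcc w v →
      (1 + |y'|) ^ k * expSq s y ≤ C * (expSq s' w + expSq s' v) := by
  obtain ⟨C, hC, hk⟩ := pow_mul_expSq_le h k
  refine ⟨C, hC, fun w v y y' hy hy' => ?_⟩
  obtain ⟨e, he, hle⟩ := exists_endpoint_abs_le w v
  have e1 := expSq_pos s' w
  have e2 := expSq_pos s' v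
  calc (1 + |y'|) ^ k * expSq s y ≤ (1 + |e|) ^ k * expSq s e := by
        have h1 := hle y' hy'
        have h2 := expSq_le_of_abs_le hs (hle y hy)
        have h3 := expSq_pos s y
        gcongr
    _ ≤ C * expSq s' e := hk e
    _ ≤ _ := by
        gcongr
        rcases he with rfl | rfl <;> linarith

lemma abs_expSq_sub_le {s s' : ℝ} (hs : 0 ≤ s) (h : s < s') :
    ∃ C : ℝ, 0 < C ∧ ∀ w v : ℝ,
      |expSq s v - expSq s w| ≤ C * (expSq s' w + expSq s' v) * |v - w| := by
  obtain ⟨C, hC, hk⟩ := segment_pow_mul_expSq_le hs h 1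
  refine ⟨s * C + 1, by positivity, fun w v => ?_⟩
  have e1 := expSq_pos s' w
  have e2 := expSq_pos s' v
  refine abs_sub_le_of_hasDerivAt_ne (z := 0) (continuous_expSq s)
    (fun x _ => hasDerivAt_expSq s x) (fun x hx => ?_)
  have h1 := hk w v x x hx hx
  have e3 := expSq_pos s x
  rw [abs_mul, abs_mul, abs_of_nonneg hs, abs_of_pos e3]
  have h2 : |x| * expSq s x ≤ C * (expSq s' w + expSq s' v) := by
    refine le_trans ?_ h1
    rw [pow_one]
    gcongr
    linarith
  nlinarith

lemma abs_steinDeriv_le {β : ℝ} (hβ : β < 1) :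
    ∃ C : ℝ, 0 < C ∧ ∀ z w : ℝ,
      (1 + |z|) * |steinDeriv β z w| ≤ C * ((1 + |w|) * expSq β w) := by
  obtain ⟨C₁, hC₁, h₁⟩ := abs_steinSol_le hβ
  obtain ⟨C₂, hC₂, h₂⟩ := abs_centredInd_le hβ
  refine ⟨C₁ + C₂, by positivity, fun z w => ?_⟩
  have e := expSq_pos β w
  have hw := abs_nonneg w
  calc (1 + |z|) * |steinDeriv β z w|
      ≤ (1 + |z|) * (|w| * |steinSol β z w| + |centredInd β z w| * expSq β w) := by
        gcongr
        unfold steinDeriv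
        refine (abs_add_le _ _).trans (le_of_eq ?_)
        rw [abs_mul, abs_mul, abs_of_pos e]
    _ = |w| * ((1 + |z|) * |steinSol β z w|)
          + ((1 + |z|) * |centredInd β z w|) * expSq β w := by ring
    _ ≤ |w| * (C₁ * expSq β w) + (C₂ * (1 + |w|)) * expSq β w := by
        have h3 := h₁ z w
        have h4 := h₂ z w
        gcongr
    _ ≤ _ := by nlinarith [mul_pos hC₁ e]

/-- Indicator that `w` is within `δ` of `z`. -/
noncomputable def nearInd (z δ w : ℝ) : ℝ := if |w - z| ≤ δ then 1 else 0

lemma nearInd_nonneg (z δ w : ℝ) : 0 ≤ nearInd z δ w := by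
  unfold nearInd; split_ifs <;> norm_num

lemma nearInd_le_one (z δ w : ℝ) : nearInd z δ w ≤ 1 := by
  unfold nearInd; split_ifs <;> norm_num

lemma abs_centredInd_sub_le (β z : ℝ) {w v δ : ℝ} (h : |v - w| ≤ δ) :
    |centredInd β z v - centredInd β z w| ≤ nearInd z δ w := by
  have := abs_le.1 h
  unfold centredInd
  rw [sub_sub_sub_cancel_right]
  split_ifs with h1 h2 h2
  · simpa using nearInd_nonneg z δ w
  · rw [nearInd, if_pos]
    · simp
    · rw [abs_le]; constructor <;> linarith
  · rw [nearInd, if_pos]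
    · simp
    · rw [abs_le]; constructor <;> linarith
  · simpa using nearInd_nonneg z δ w

lemma abs_sub_le_of_mem_uIcc {w u v : ℝ} (hv : v ∈ Set.uIcc w (w + u)) : |v - w| ≤ |u| := by
  have := Set.abs_sub_left_of_mem_uIcc hv
  simpa using this

lemma abs_steinDeriv_sub_le {β s : ℝ} (hβ0 : 0 ≤ β) (hβ : β < 1) (hs : β < s) :
    ∃ C : ℝ, 0 < C ∧ ∀ z w u v : ℝ, v ∈ Set.uIcc w (w + u) →
      (1 + |z|) * |steinDeriv β z v - steinDeriv β z w| ≤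
        C * (|u| * (expSq s w + expSq s (w + u)))
          + (1 + |z|) * (nearInd z |u| w * expSq β w) := by
  obtain ⟨C₁, hC₁, h₁⟩ := abs_steinSol_le hβ
  obtain ⟨C₂, hC₂, h₂⟩ := abs_centredInd_le hβ
  obtain ⟨C₃, hC₃, h₃⟩ := abs_steinDeriv_le hβ
  obtain ⟨C₄, hC₄, h₄⟩ := segment_pow_mul_expSq_le hβ0 hs 2
  refine ⟨(C₁ + C₃) * C₄ + C₂ * C₄, by positivity, fun z w u v hv => ?_⟩
  have hz : 0 < 1 + |z| := by positivity
  have hvu := abs_sub_le_of_mem_uIcc hv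
  have hsub : Set.uIcc w v ⊆ Set.uIcc w (w + u) :=
    Set.uIcc_subset_uIcc Set.left_mem_uIcc hv
  set S := expSq s w + expSq s (w + u) with hS
  have hS0 : 0 < S := add_pos (expSq_pos _ _) (expSq_pos _ _)
  have hψ : (1 + |z|) * |v * steinSol β z v - w * steinSol β z w|
      ≤ (C₁ + C₃) * C₄ * (|u| * S) := by
    have := abs_sub_le_of_hasDerivAt_ne (f := fun x => x * steinSol β z x)
      (f' := fun x => 1 * steinSol β z x + x * steinDeriv β z x) (a := w) (b := v) (z := z)
      (M := (C₁ + C₃) * C₄ * S / (1 + |z|))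
      (continuous_id.mul (continuous_steinSol hβ z))
      (fun x hx => (hasDerivAt_id x).mul (hasDerivAt_steinSol hβ hx))
      (fun x hx => by
        rw [le_div_iff₀ hz]
        have e := expSq_pos β x
        have hx0 := abs_nonneg x
        calc |1 * steinSol β z x + x * steinDeriv β z x| * (1 + |z|)
            ≤ (|steinSol β z x| + |x| * |steinDeriv β z x|) * (1 + |z|) := by
              gcongr
              refine (abs_add_le _ _).trans (le_of_eq ?_)
              rw [abs_mul, abs_mul, abs_one, one_mul]
          _ = (1 + |z|) * |steinSol β z x| + |x| * ((1 + |z|) * |steinDeriv β z x|) := by ring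
          _ ≤ C₁ * expSq β x + |x| * (C₃ * ((1 + |x|) * expSq β x)) := by
              have h5 := h₁ z x
              have h6 := h₃ z x
              gcongr
          _ ≤ (C₁ + C₃) * ((1 + |x|) ^ 2 * expSq β x) := by
              have : 0 ≤ C₁ * (expSq β x * |x|) := by positivity
              have : 0 ≤ C₁ * (expSq β x * |x| ^ 2) := by positivity
              have : 0 ≤ C₃ * (expSq β x * |x|) := by positivity
              have : 0 ≤ C₃ * expSq β x := by positivity
              nlinarith
          _ ≤ (C₁ + C₃) * (C₄ * S) := by
              have h7 := h₄ w (w + u) x x (hsub hx) (hsub hx)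
              gcongr
          _ = _ := by ring)
    calc (1 + |z|) * |v * steinSol β z v - w * steinSol β z w|
        ≤ (1 + |z|) * ((C₁ + C₃) * C₄ * S / (1 + |z|) * |u|) := by
          gcongr
          exact this.trans (by gcongr)
      _ = _ := by field_simp
  have hφ : (1 + |z|) * (|centredInd β z v| * |expSq β v - expSq β w|)
      ≤ C₂ * C₄ * (|u| * S) := by
    have := abs_sub_le_of_hasDerivAt_ne (f := expSq β) (f' := fun x => β * x * expSq β x)
      (a := w) (b := v) (z := 0) (M := C₄ * S / (1 + |v|)) (continuous_expSq β)
      (fun x _ => hasDerivAt_expSq β x)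
      (fun x hx => by
        rw [le_div_iff₀ (by positivity)]
        have e := expSq_pos β x
        obtain ⟨y, hy, hyle⟩ := exists_endpoint_abs_le w (w + u)
        have hymem : y ∈ Set.uIcc w (w + u) := by
          rcases hy with rfl | rfl
          · exact Set.left_mem_uIcc
          · exact Set.right_mem_uIcc
        rw [abs_mul, abs_mul, abs_of_nonneg hβ0, abs_of_pos e]
        calc β * |x| * expSq β x * (1 + |v|) ≤ 1 * |y| * expSq β x * (1 + |y|) := by
              have h8 := hyle x (hsub hx)
              have h9 := hyle v hv
              gcongr
          _ ≤ (1 + |y|) ^ 2 * expSq β x := by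
              nlinarith [mul_nonneg (abs_nonneg y) e.le]
          _ ≤ C₄ * S := h₄ w (w + u) x y (hsub hx) hymem)
    calc (1 + |z|) * (|centredInd β z v| * |expSq β v - expSq β w|)
        = ((1 + |z|) * |centredInd β z v|) * |expSq β v - expSq β w| := by ring
      _ ≤ (C₂ * (1 + |v|)) * (C₄ * S / (1 + |v|) * |u|) := by
          have h5 := h₂ z v
          have h6 : |expSq β v - expSq β w| ≤ C₄ * S / (1 + |v|) * |u| :=
            this.trans (by gcongr)
          gcongr
      _ = _ := by field_simp
  have hp : (1 + |z|) * (|centredInd β z v - centredInd β z w| * expSq β w)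
      ≤ (1 + |z|) * (nearInd z |u| w * expSq β w) := by
    gcongr
    · exact (expSq_pos _ _).le
    · exact abs_centredInd_sub_le β z hvu
  have hsum : |steinDeriv β z v - steinDeriv β z w| ≤
      |v * steinSol β z v - w * steinSol β z w|
        + |centredInd β z v| * |expSq β v - expSq β w|
        + |centredInd β z v - centredInd β z w| * expSq β w := by
    have : steinDeriv β z v - steinDeriv β z w =
      (v * steinSol β z v - w * steinSol β z w)
        + centredInd β z v * (expSq β v - expSq β w)
        + (centredInd β z v - centredInd β z w) * expSq β w := by
      unfold steinDeriv; ring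
    rw [this]
    refine (abs_add_three _ _ _).trans (le_of_eq ?_)
    rw [abs_mul, abs_mul, abs_of_pos (expSq_pos β w)]
  calc _ ≤ (1 + |z|) * (|v * steinSol β z v - w * steinSol β z w|
        + |centredInd β z v| * |expSq β v - expSq β w|
        + |centredInd β z v - centredInd β z w| * expSq β w) := by gcongr
    _ ≤ _ := by linarith

/-- First order Taylor bound for the Stein solution. -/
lemma abs_steinSol_taylor_le {β s : ℝ} (hβ0 : 0 ≤ β) (hβ : β < 1) (hs : β < s) :
    ∃ C : ℝ, 0 < C ∧ ∀ z w u : ℝ,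
      ((1 + |z|) * |steinDeriv β z (w + u) - steinDeriv β z w| ≤
        C * (|u| * (expSq s w + expSq s (w + u)))
          + (1 + |z|) * (nearInd z |u| w * expSq β w)) ∧
      ((1 + |z|) * |steinSol β z (w + u) - steinSol β z w - u * steinDeriv β z w| ≤
        |u| * (C * (|u| * (expSq s w + expSq s (w + u)))
          + (1 + |z|) * (nearInd z |u| w * expSq β w))) := by
  obtain ⟨C, hC, h⟩ := abs_steinDeriv_sub_le hβ0 hβ hs
  refine ⟨C, hC, fun z w u => ⟨h z w u (w + u) Set.right_mem_uIcc, ?_⟩⟩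
  have hz : 0 < 1 + |z| := by positivity
  set B := C * (|u| * (expSq s w + expSq s (w + u)))
    + (1 + |z|) * (nearInd z |u| w * expSq β w) with hB
  have := abs_sub_le_of_hasDerivAt_ne (f := fun x => steinSol β z x - x * steinDeriv β z w)
    (f' := fun x => steinDeriv β z x - 1 * steinDeriv β z w) (a := w) (b := w + u) (z := z)
    (M := B / (1 + |z|))
    ((continuous_steinSol hβ z).sub (continuous_id.mul continuous_const))
    (fun x hx => (hasDerivAt_steinSol hβ hx).sub ((hasDerivAt_id x).mul_const _))
    (fun x hx => by
      rw [le_div_iff₀ hz, mul_comm, one_mul]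
      exact h z w u x hx)
  rw [add_sub_cancel_left] at this
  rw [show steinSol β z (w + u) - steinSol β z w - u * steinDeriv β z w
    = steinSol β z (w + u) - (w + u) * steinDeriv β z w
      - (steinSol β z w - w * steinDeriv β z w) by ring]
  calc _ ≤ (1 + |z|) * (B / (1 + |z|) * |u|) := by gcongr
    _ = |u| * B := by field_simp
/-- `μ` is the law of one summand `X`, `ν` the law of the scaled sum `T'` of the remaining ones,
and `T = T' + a X`. -/
structure LeaveOneOut (b a : ℝ) (μ ν : Measure ℝ) : Prop where
  a_pos : 0 < a
  a_le_one : a ≤ 1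
  mean_zero : ∫ x, x ∂μ = 0
  variance_one : ∫ x, x ^ 2 ∂μ = 1
  lintegral_exp_fst (t : ℝ) : ∫⁻ x, ENNReal.ofReal (Real.exp (t * x)) ∂μ
    ≤ ENNReal.ofReal (Real.exp (t ^ 2 / (2 * b)))
  lintegral_exp_snd (t : ℝ) : ∫⁻ x, ENNReal.ofReal (Real.exp (t * x)) ∂ν
    ≤ ENNReal.ofReal (Real.exp (t ^ 2 / (2 * b)))
  lintegral_exp_sum (t : ℝ) : ∫⁻ q, ENNReal.ofReal (Real.exp (t * (q.2 + a * q.1))) ∂(μ.prod ν)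
    ≤ ENNReal.ofReal (Real.exp (t ^ 2 / (2 * b)))
  integral_sum_mul (G : ℝ → ℝ) (hG : Continuous G)
    (hi : Integrable (fun q : ℝ × ℝ => q.1 * G (q.2 + a * q.1)) (μ.prod ν)) :
    ∫ q, (q.2 + a * q.1) * G (q.2 + a * q.1) ∂(μ.prod ν)
      = a⁻¹ * ∫ q, q.1 * G (q.2 + a * q.1) ∂(μ.prod ν)

/-- The dominating function for all integrands. -/
noncomputable def domFun (s a : ℝ) (q : ℝ × ℝ) : ℝ :=
  Real.exp |q.1| + expSq s q.2 + expSq s (q.2 + a * q.1)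

lemma domFun_pos (s a : ℝ) (q : ℝ × ℝ) : 0 < domFun s a q := by
  have := expSq_pos s q.2
  have := expSq_pos s (q.2 + a * q.1)
  unfold domFun
  positivity

lemma measurable_domFun (s a : ℝ) : Measurable (domFun s a) := by
  have h := measurable_expSq s
  unfold domFun
  fun_prop

lemma pow_mul_le_domFun {s s' : ℝ} (h : s < s') (k : ℕ) :
    ∃ C : ℝ, 0 < C ∧ ∀ a x w : ℝ,
      (1 + |x|) ^ k * (expSq s w + expSq s (w + a * x)) ≤ C * domFun s' a (x, w) := by
  obtain ⟨C, hC, hk⟩ := pow_mul_expSq_le_exp_add h k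
  refine ⟨2 * C, by positivity, fun a x w => ?_⟩
  have h1 := hk x w
  have h2 := hk x (w + a * x)
  have h3 := mul_pos hC (expSq_pos s' w)
  have h4 := mul_pos hC (expSq_pos s' (w + a * x))
  unfold domFun
  simp only
  nlinarith

lemma LeaveOneOut.lintegral_exp_abs {b a : ℝ} {μ ν : Measure ℝ} (h : LeaveOneOut b a μ ν) :
    ∫⁻ x, ENNReal.ofReal (Real.exp |x|) ∂μ ≤ ENNReal.ofReal (2 * Real.exp (1 / (2 * b))) := by
  have h1 := h.lintegral_exp_fst 1
  have h2 := h.lintegral_exp_fst (-1)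
  calc ∫⁻ x, ENNReal.ofReal (Real.exp |x|) ∂μ
      ≤ ∫⁻ x, ENNReal.ofReal (Real.exp (1 * x)) + ENNReal.ofReal (Real.exp (-1 * x)) ∂μ := by
        refine lintegral_mono fun x => ?_
        rw [← ENNReal.ofReal_add (by positivity) (by positivity)]
        apply ENNReal.ofReal_le_ofReal
        have e1 := Real.exp_pos (1 * x)
        have e2 := Real.exp_pos (-1 * x)
        rcases abs_choice x with hx | hx <;> rw [hx]
        · rw [one_mul] at *; linarith
        · rw [neg_one_mul] at *; linarith
    _ = (∫⁻ x, ENNReal.ofReal (Real.exp (1 * x)) ∂μ)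
          + ∫⁻ x, ENNReal.ofReal (Real.exp (-1 * x)) ∂μ :=
        lintegral_add_left (by fun_prop) _
    _ ≤ _ := add_le_add h1 h2
    _ = _ := by
        rw [← ENNReal.ofReal_add (by positivity) (by positivity)]
        congr 1
        norm_num
        ring

lemma integrable_and_integral_le_of_lintegral_le {Ω : Type*} [MeasurableSpace Ω] {ρ : Measure Ω}
    {f : Ω → ℝ} (hf : Measurable f) (h0 : ∀ x, 0 ≤ f x) {c : ENNReal} (hc : c ≠ ⊤)
    (h : ∫⁻ x, ENNReal.ofReal (f x) ∂ρ ≤ c) : Integrable f ρ ∧ ∫ x, f x ∂ρ ≤ c.toReal := by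
  constructor
  · refine ⟨hf.aestronglyMeasurable, ?_⟩
    rw [hasFiniteIntegral_iff_ofReal (ae_of_all _ h0)]
    exact lt_of_le_of_lt h hc.lt_top
  · rw [integral_eq_lintegral_of_nonneg_ae (ae_of_all _ h0) hf.aestronglyMeasurable]
    exact ENNReal.toReal_mono hc h

lemma LeaveOneOut.exp_abs {b a : ℝ} {μ ν : Measure ℝ} (h : LeaveOneOut b a μ ν) :
    Integrable (fun x : ℝ => Real.exp |x|) μ ∧
      ∫ x, Real.exp |x| ∂μ ≤ 2 * Real.exp (1 / (2 * b)) := by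
  have := integrable_and_integral_le_of_lintegral_le (f := fun x : ℝ => Real.exp |x|)
    (by fun_prop) (fun x => (Real.exp_pos _).le) ENNReal.ofReal_ne_top h.lintegral_exp_abs
  rwa [ENNReal.toReal_ofReal (by positivity)] at this

lemma exists_integral_domFun_le {b s : ℝ} (hs : 0 ≤ s) (hsb : s < b) :
    ∃ C : ℝ, 0 < C ∧ ∀ (a : ℝ) (μ ν : Measure ℝ) [IsProbabilityMeasure μ]
      [IsProbabilityMeasure ν], LeaveOneOut b a μ ν →
      Integrable (domFun s a) (μ.prod ν) ∧ ∫ q, domFun s a q ∂(μ.prod ν) ≤ C := by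
  have hb : 0 < b := by linarith
  set g : ENNReal := ∫⁻ z, ENNReal.ofReal (expSq (s / b) z) ∂(gaussianReal 0 1) with hg
  have hgt : g ≠ ⊤ := (lintegral_expSq_gaussian_lt_top ((div_lt_one hb).2 hsb)).ne
  set c : ENNReal := ENNReal.ofReal (2 * Real.exp (1 / (2 * b))) + g + g with hc
  have hct : c ≠ ⊤ :=
    ENNReal.add_ne_top.2 ⟨ENNReal.add_ne_top.2 ⟨ENNReal.ofReal_ne_top, hgt⟩, hgt⟩
  refine ⟨c.toReal + 1, by positivity, fun a μ ν _ _ h => ?_⟩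
  have hm := measurable_expSq s
  have h1 : ∫⁻ q, ENNReal.ofReal (Real.exp |q.1|) ∂(μ.prod ν)
      ≤ ENNReal.ofReal (2 * Real.exp (1 / (2 * b))) := by
    rw [lintegral_prod _ (by fun_prop)]
    simpa using h.lintegral_exp_abs
  have h2 : ∫⁻ q, ENNReal.ofReal (expSq s q.2) ∂(μ.prod ν) ≤ g := by
    rw [lintegral_prod _ (by fun_prop)]
    simpa using lintegral_expSq_le hs ν h.lintegral_exp_snd
  have h3 : ∫⁻ q, ENNReal.ofReal (expSq s (q.2 + a * q.1)) ∂(μ.prod ν) ≤ g := by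
    have hT : Measurable fun q : ℝ × ℝ => q.2 + a * q.1 := by fun_prop
    have := lintegral_expSq_le (b := b) hs ((μ.prod ν).map fun q => q.2 + a * q.1) (fun t => by
      rw [lintegral_map (by fun_prop) hT]
      exact h.lintegral_exp_sum t)
    rwa [lintegral_map (by fun_prop) hT] at this
  have := integrable_and_integral_le_of_lintegral_le (measurable_domFun s a)
    (fun q => (domFun_pos s a q).le) hct (ρ := μ.prod ν) (by
      calc ∫⁻ q, ENNReal.ofReal (domFun s a q) ∂(μ.prod ν)
          = ∫⁻ q, ENNReal.ofReal (Real.exp |q.1|) + ENNReal.ofReal (expSq s q.2)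
              + ENNReal.ofReal (expSq s (q.2 + a * q.1)) ∂(μ.prod ν) := by
            refine lintegral_congr fun q => ?_
            have := expSq_pos s q.2
            have := expSq_pos s (q.2 + a * q.1)
            rw [domFun, ENNReal.ofReal_add (by positivity) (by positivity),
              ENNReal.ofReal_add (by positivity) (by positivity)]
        _ = _ := by
            rw [lintegral_add_left (by fun_prop), lintegral_add_left (by fun_prop)]
        _ ≤ c := add_le_add (add_le_add h1 h2) h3)
  exact ⟨this.1, by linarith [this.2]⟩

section

variable {b a : ℝ} {μ ν : Measure ℝ} [IsProbabilityMeasure μ] [IsProbabilityMeasure ν]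

lemma LeaveOneOut.integrable_of_le (h : LeaveOneOut b a μ ν) {s : ℝ} (hs : 0 ≤ s) (hsb : s < b)
    {F : ℝ × ℝ → ℝ} (hF : Measurable F) {K : ℝ} (hK : ∀ q, |F q| ≤ K * domFun s a q) :
    Integrable F (μ.prod ν) := by
  obtain ⟨C, -, hC⟩ := exists_integral_domFun_le hs hsb
  exact ((hC a μ ν h).1.const_mul K).mono' hF.aestronglyMeasurable (ae_of_all _ hK)

lemma LeaveOneOut.integrable_mul (h : LeaveOneOut b a μ ν) {s : ℝ} (hs : 0 ≤ s) (hsb : s < b)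
    {f p : ℝ → ℝ} (hf : Measurable f) (hp : Measurable p) {K : ℝ} (k : ℕ)
    (hfK : ∀ w, |f w| ≤ K * expSq s w) (hpk : ∀ x, |p x| ≤ (1 + |x|) ^ k) :
    Integrable (fun q : ℝ × ℝ => p q.1 * f q.2) (μ.prod ν) ∧
      Integrable (fun q : ℝ × ℝ => p q.1 * f (q.2 + a * q.1)) (μ.prod ν) := by
  obtain ⟨s', hss', hs'b⟩ := exists_between hsb
  obtain ⟨C, hC, hCk⟩ := pow_mul_le_domFun hss' k
  have hK : 0 ≤ K := by
    have := (abs_nonneg _).trans (hfK 0)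
    exact nonneg_of_mul_nonneg_left this (expSq_pos s 0)
  have key : ∀ q : ℝ × ℝ, ∀ y : ℝ, y = q.2 ∨ y = q.2 + a * q.1 →
      |p q.1 * f y| ≤ K * C * domFun s' a q := by
    intro q y hy
    have e1 := expSq_pos s q.2
    have e2 := expSq_pos s (q.2 + a * q.1)
    have e3 : expSq s y ≤ expSq s q.2 + expSq s (q.2 + a * q.1) := by
      rcases hy with rfl | rfl <;> linarith
    rw [abs_mul]
    calc |p q.1| * |f y| ≤ (1 + |q.1|) ^ k * (K * (expSq s q.2 + expSq s (q.2 + a * q.1))) := by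
          have h1 := hpk q.1
          have h2 : |f y| ≤ K * (expSq s q.2 + expSq s (q.2 + a * q.1)) :=
            (hfK y).trans (by gcongr)
          gcongr
      _ = K * ((1 + |q.1|) ^ k * (expSq s q.2 + expSq s (q.2 + a * q.1))) := by ring
      _ ≤ K * (C * domFun s' a q) := by
          have := hCk a q.1 q.2
          gcongr
      _ = _ := by ring
  exact ⟨h.integrable_of_le (hs.trans hss'.le) hs'b (by fun_prop) fun q => key q _ (Or.inl rfl),
    h.integrable_of_le (hs.trans hss'.le) hs'b (by fun_prop) fun q => key q _ (Or.inr rfl)⟩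

end
/-- The identity shifted by `z` and truncated at level `r`. -/
noncomputable def clampFun (z r w : ℝ) : ℝ := max (-r) (min (w - z) r)

lemma continuous_clampFun (z r : ℝ) : Continuous (clampFun z r) := by
  unfold clampFun; fun_prop

lemma abs_clampFun_le {r : ℝ} (hr : 0 ≤ r) (z w : ℝ) : |clampFun z r w| ≤ r := by
  unfold clampFun
  rw [abs_le]
  exact ⟨le_max_left _ _, max_le (by linarith) (min_le_right _ _)⟩

lemma monotone_clampFun (z r : ℝ) : Monotone (clampFun z r) := by
  intro w v h
  unfold clampFun
  gcongr

lemma le_mul_clampFun_sub {z δ a c : ℝ} (ha : 0 ≤ a) (hc : 0 ≤ c) (x w : ℝ) :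
    a * (|x| * min |x| c) * nearInd z δ w
      ≤ x * (clampFun z (δ + c * a) (w + a * x) - clampFun z (δ + c * a) w) := by
  have hca : 0 ≤ c * a := mul_nonneg hc ha
  by_cases hn : |w - z| ≤ δ
  · have hn' := abs_le.1 hn
    have hk : clampFun z (δ + c * a) w = w - z := by
      unfold clampFun
      rw [min_eq_left (by linarith), max_eq_right (by linarith)]
    rw [nearInd, if_pos hn, mul_one, hk]
    have hmin : 0 ≤ min |x| c := le_min (abs_nonneg x) hc
    have hm1 := mul_le_mul_of_nonneg_left (min_le_left |x| c) ha
    have hm2 := mul_le_mul_of_nonneg_left (min_le_right |x| c) ha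
    have hm0 := mul_nonneg ha hmin
    rcases le_total 0 x with hx | hx
    · rw [abs_of_nonneg hx] at *
      have : a * min x c ≤ clampFun z (δ + c * a) (w + a * x) - (w - z) := by
        have : a * min x c + (w - z) ≤ clampFun z (δ + c * a) (w + a * x) :=
          le_max_of_le_right (le_min (by linarith) (by linarith))
        linarith
      calc a * (x * min x c) = x * (a * min x c) := by ring
        _ ≤ _ := by gcongr
    · rw [abs_of_nonpos hx] at *
      have : a * min (-x) c ≤ (w - z) - clampFun z (δ + c * a) (w + a * x) := by
        have : clampFun z (δ + c * a) (w + a * x) ≤ (w - z) - a * min (-x) c :=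
          max_le (by linarith) (min_le_of_left_le (by linarith))
        linarith
      calc a * (-x * min (-x) c) = -x * (a * min (-x) c) := by ring
        _ ≤ -x * ((w - z) - clampFun z (δ + c * a) (w + a * x)) := by
          gcongr
          linarith
        _ = _ := by ring
  · rw [nearInd, if_neg hn, mul_zero]
    rcases le_total 0 x with hx | hx
    · have := monotone_clampFun z (δ + c * a) (show w ≤ w + a * x by nlinarith)
      exact mul_nonneg hx (sub_nonneg.2 this)
    · have := monotone_clampFun z (δ + c * a) (show w + a * x ≤ w by nlinarith)
      exact mul_nonneg_of_nonpos_of_nonpos hx (sub_nonpos.2 this)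

lemma measurable_nearInd (z δ : ℝ) : Measurable (nearInd z δ) := by
  unfold nearInd
  exact Measurable.ite (measurableSet_le (by fun_prop) measurable_const) measurable_const
    measurable_const

lemma LeaveOneOut.integrable_pow {b a : ℝ} {μ ν : Measure ℝ} (h : LeaveOneOut b a μ ν)
    {p : ℝ → ℝ} (hp : Measurable p) (k : ℕ) (hpk : ∀ x, |p x| ≤ (1 + |x|) ^ k) :
    Integrable p μ := by
  obtain ⟨C, hC, hk⟩ := one_add_pow_le_exp k
  exact (h.exp_abs.1.const_mul C).mono' hp.aestronglyMeasurable
    (ae_of_all _ fun x => (hpk x).trans (hk x))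

lemma exists_integral_pow_le (b : ℝ) (k : ℕ) :
    ∃ C : ℝ, 0 < C ∧ ∀ (a : ℝ) (μ ν : Measure ℝ), LeaveOneOut b a μ ν →
      ∫ x, (1 + |x|) ^ k ∂μ ≤ C := by
  obtain ⟨C, hC, hk⟩ := one_add_pow_le_exp k
  refine ⟨C * (2 * Real.exp (1 / (2 * b))), by positivity, fun a μ ν h => ?_⟩
  calc ∫ x, (1 + |x|) ^ k ∂μ ≤ ∫ x, C * Real.exp |x| ∂μ :=
        integral_mono (h.integrable_pow (by fun_prop) k fun x => by
          rw [abs_of_nonneg (by positivity)]) (h.exp_abs.1.const_mul C) hk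
    _ = C * ∫ x, Real.exp |x| ∂μ := integral_const_mul _ _
    _ ≤ _ := by
        have := h.exp_abs.2
        gcongr

lemma abs_pow_le_one_add_pow (x : ℝ) (k : ℕ) : |x ^ k| ≤ (1 + |x|) ^ k := by
  rw [abs_pow]
  gcongr
  linarith

/-- The truncated second moment is bounded below at a level depending only on `b`. -/
lemma exists_half_le_integral_truncated (b : ℝ) :
    ∃ c : ℝ, 0 < c ∧ ∀ (a : ℝ) (μ ν : Measure ℝ), LeaveOneOut b a μ ν →
      1 / 2 ≤ ∫ x, |x| * min |x| c ∂μ := by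
  obtain ⟨M, hM, h3⟩ := exists_integral_pow_le b 3
  refine ⟨2 * M, by positivity, fun a μ ν h => ?_⟩
  have hsq : Integrable (fun x : ℝ => x ^ 2) μ :=
    h.integrable_pow (by fun_prop) 2 fun x => abs_pow_le_one_add_pow x 2
  have hcu : Integrable (fun x : ℝ => (1 + |x|) ^ 3) μ :=
    h.integrable_pow (by fun_prop) 3 fun x => by rw [abs_of_nonneg (by positivity)]
  have hmin : Integrable (fun x : ℝ => |x| * min |x| (2 * M)) μ := by
    refine h.integrable_pow (by fun_prop) 2 fun x => ?_
    have h0 : 0 ≤ min |x| (2 * M) := le_min (abs_nonneg x) (by positivity)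
    rw [abs_of_nonneg (mul_nonneg (abs_nonneg x) h0)]
    have := min_le_left |x| (2 * M)
    have hx := abs_nonneg x
    nlinarith
  have hpt : ∀ x : ℝ, x ^ 2 - (2 * M)⁻¹ * (1 + |x|) ^ 3 ≤ |x| * min |x| (2 * M) := by
    intro x
    have hx := abs_nonneg x
    have hc3 : |x| ^ 3 ≤ (1 + |x|) ^ 3 := by gcongr; linarith
    rw [← sq_abs]
    rcases le_total |x| (2 * M) with hle | hle
    · rw [min_eq_left hle]
      have : 0 ≤ (2 * M)⁻¹ * (1 + |x|) ^ 3 := by positivity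
      nlinarith
    · have h0 : 0 ≤ |x| * min |x| (2 * M) :=
        mul_nonneg hx (le_min hx (by positivity))
      have : |x| ^ 2 ≤ (2 * M)⁻¹ * (1 + |x|) ^ 3 := by
        rw [inv_mul_eq_div, le_div_iff₀ (by positivity)]
        nlinarith [mul_le_mul_of_nonneg_left hle (sq_nonneg |x|)]
      linarith
  have := integral_mono (hsq.sub (hcu.const_mul (2 * M)⁻¹)) hmin hpt
  rw [integral_sub' hsq (hcu.const_mul _), h.variance_one, integral_const_mul] at this
  have h4 : (2 * M)⁻¹ * ∫ x, (1 + |x|) ^ 3 ∂μ ≤ 1 / 2 := by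
    calc _ ≤ (2 * M)⁻¹ * M := by
          have := h3 a μ ν h
          gcongr
      _ = 1 / 2 := by field_simp
  linarith

/-- A weighted concentration inequality for the leave-one-out sum. -/
lemma exists_concentration {b s : ℝ} (hs : 0 ≤ s) (hsb : s < b) :
    ∃ C : ℝ, 0 < C ∧ ∀ (a : ℝ) (μ ν : Measure ℝ) [IsProbabilityMeasure μ]
      [IsProbabilityMeasure ν], LeaveOneOut b a μ ν → ∀ z δ : ℝ, 0 ≤ δ →
      ∫ w, nearInd z δ w * expSq s w ∂ν ≤ C * (δ + a) := by
  obtain ⟨s₁, hss₁, hs₁b⟩ := exists_between hsb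
  obtain ⟨s₂, hs₁₂, hs₂b⟩ := exists_between hs₁b
  have hs1 : 0 ≤ s₁ := hs.trans hss₁.le
  have hs2 : 0 ≤ s₂ := hs1.trans hs₁₂.le
  obtain ⟨c, hc, hhalf⟩ := exists_half_le_integral_truncated b
  obtain ⟨C₁, hC₁, h₁⟩ := abs_expSq_sub_le hs hss₁
  obtain ⟨C₂, hC₂, h₂⟩ := pow_mul_le_domFun hs₁₂ 2
  obtain ⟨C₃, hC₃, h₃⟩ := pow_mul_expSq_le hss₁ 1
  obtain ⟨I, hI, hdom⟩ := exists_integral_domFun_le hs2 hs₂b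
  refine ⟨2 * ((C₁ + C₃) * C₂ * I) * (1 + c), by positivity, fun a μ ν _ _ h z δ hδ => ?_⟩
  obtain ⟨hDi, hDI⟩ := hdom a μ ν h
  have ha := h.a_pos
  set r : ℝ := δ + c * a with hr
  have hr0 : 0 ≤ r := by positivity
  set G : ℝ → ℝ := fun w => clampFun z r w * expSq s w with hG
  have hGc : Continuous G := (continuous_clampFun z r).mul (continuous_expSq s)
  have hGb : ∀ w, |G w| ≤ r * expSq s w := fun w => by
    have e := expSq_pos s w
    rw [hG]
    simp only
    rw [abs_mul, abs_of_pos e]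
    have := abs_clampFun_le hr0 z w
    gcongr
  have hid : ∀ x : ℝ, |x| ≤ (1 + |x|) ^ 1 := fun x => by linarith
  obtain ⟨hi1, hi2⟩ := h.integrable_mul hs hsb hGc.measurable measurable_id 1 hGb hid
  simp only [id] at hi1 hi2
  have hzero : ∫ q : ℝ × ℝ, q.1 * G q.2 ∂(μ.prod ν) = 0 := by
    rw [integral_prod_mul (fun x : ℝ => x) G, h.mean_zero, zero_mul]
  have hN : Measurable fun w => nearInd z δ w * expSq s w :=
    (measurable_nearInd z δ).mul (measurable_expSq s)
  have hNb : ∀ w, |nearInd z δ w * expSq s w| ≤ 1 * expSq s w := fun w => by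
    have e := expSq_pos s w
    rw [abs_mul, abs_of_pos e, abs_of_nonneg (nearInd_nonneg z δ w)]
    have := nearInd_le_one z δ w
    gcongr
  have hP : Measurable fun x : ℝ => |x| * min |x| c := by fun_prop
  have hPb : ∀ x : ℝ, |(|x| * min |x| c)| ≤ (1 + |x|) ^ 2 := fun x => by
    have h0 : 0 ≤ min |x| c := le_min (abs_nonneg x) hc.le
    rw [abs_of_nonneg (mul_nonneg (abs_nonneg x) h0)]
    have := min_le_left |x| c
    have hx := abs_nonneg x
    nlinarith
  have hi3 := (h.integrable_mul hs hsb hN hP 2 hNb hPb).1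
  have hTG : Integrable (fun q : ℝ × ℝ => (q.2 + a * q.1) * G (q.2 + a * q.1)) (μ.prod ν) := by
    have := (h.integrable_mul hs1 hs₁b (f := fun w => w * G w) (p := fun _ => 1) (K := C₃ * r)
      (measurable_id.mul hGc.measurable) measurable_const 0 (fun w => by
        rw [abs_mul]
        have e := expSq_pos s w
        have hw := abs_nonneg w
        calc |w| * |G w| ≤ (1 + |w|) ^ 1 * (r * expSq s w) := by
              have := hGb w
              have := hid w
              gcongr
          _ = r * ((1 + |w|) ^ 1 * expSq s w) := by ring
          _ ≤ r * (C₃ * expSq s₁ w) := by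
              have := h₃ w
              gcongr
          _ = _ := by ring) (by simp)).2
    simpa using this
  have hpt : ∀ q : ℝ × ℝ, |q.1| * min |q.1| c * (nearInd z δ q.2 * expSq s q.2)
      ≤ a⁻¹ * (q.1 * G (q.2 + a * q.1) - q.1 * G q.2) + r * C₁ * C₂ * domFun s₂ a q := by
    rintro ⟨x, w⟩
    simp only
    have e := expSq_pos s w
    have k1 := le_mul_clampFun_sub (z := z) (δ := δ) ha.le hc.le x w
    have k2 : -(x * (clampFun z r (w + a * x) * (expSq s (w + a * x) - expSq s w)))
        ≤ a * (r * C₁ * C₂ * domFun s₂ a (x, w)) := by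
      refine (neg_le_abs _).trans ?_
      rw [abs_mul, abs_mul]
      have e1 := expSq_pos s₁ w
      have e2 := expSq_pos s₁ (w + a * x)
      calc |x| * (|clampFun z r (w + a * x)| * |expSq s (w + a * x) - expSq s w|)
          ≤ |x| * (r * (C₁ * (expSq s₁ w + expSq s₁ (w + a * x)) * (a * |x|))) := by
            have m1 := abs_clampFun_le hr0 z (w + a * x)
            have m2 := h₁ w (w + a * x)
            rw [add_sub_cancel_left, abs_mul, abs_of_pos ha] at m2
            gcongr
        _ = a * (r * C₁) * (|x| ^ 2 * (expSq s₁ w + expSq s₁ (w + a * x))) := by ring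
        _ ≤ a * (r * C₁) * ((1 + |x|) ^ 2 * (expSq s₁ w + expSq s₁ (w + a * x))) := by
            gcongr
            linarith
        _ ≤ a * (r * C₁) * (C₂ * domFun s₂ a (x, w)) := by
            have := h₂ a x w
            gcongr
        _ = _ := by ring
    have k3 : a * (|x| * min |x| c * (nearInd z δ w * expSq s w))
        ≤ (x * G (w + a * x) - x * G w) + a * (r * C₁ * C₂ * domFun s₂ a (x, w)) := by
      have := mul_le_mul_of_nonneg_right k1 e.le
      simp only [hG]
      nlinarith
    have k4 := mul_le_mul_of_nonneg_left k3 (inv_pos.2 ha).le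
    rw [inv_mul_cancel_left₀ ha.ne', mul_add, inv_mul_cancel_left₀ ha.ne'] at k4
    exact k4
  have hpt2 : ∀ q : ℝ × ℝ, (q.2 + a * q.1) * G (q.2 + a * q.1)
      ≤ r * C₃ * C₂ * domFun s₂ a q := by
    rintro ⟨x, w⟩
    simp only
    refine (le_abs_self _).trans ?_
    rw [abs_mul]
    have e := expSq_pos s (w + a * x)
    have e1 := expSq_pos s₁ w
    have e2 := expSq_pos s₁ (w + a * x)
    calc |w + a * x| * |G (w + a * x)| ≤ (1 + |w + a * x|) ^ 1 * (r * expSq s (w + a * x)) := by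
          have := hGb (w + a * x)
          have := hid (w + a * x)
          gcongr
      _ = r * ((1 + |w + a * x|) ^ 1 * expSq s (w + a * x)) := by ring
      _ ≤ r * (C₃ * expSq s₁ (w + a * x)) := by
          have := h₃ (w + a * x)
          gcongr
      _ ≤ r * (C₃ * ((1 + |x|) ^ 2 * (expSq s₁ w + expSq s₁ (w + a * x)))) := by
          gcongr
          have : 1 ≤ (1 + |x|) ^ 2 := one_le_pow₀ (by linarith [abs_nonneg x])
          nlinarith
      _ ≤ r * (C₃ * (C₂ * domFun s₂ a (x, w))) := by
          have := h₂ a x w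
          gcongr
      _ = _ := by ring
  have hmain := integral_mono hi3
    (((hi2.sub hi1).const_mul a⁻¹).add (hDi.const_mul (r * C₁ * C₂))) hpt
  rw [integral_prod_mul (fun x : ℝ => |x| * min |x| c) (fun w => nearInd z δ w * expSq s w),
    integral_add' ((hi2.sub hi1).const_mul a⁻¹) (hDi.const_mul _), integral_const_mul,
    integral_sub' hi2 hi1, hzero, sub_zero, ← h.integral_sum_mul G hGc hi2,
    integral_const_mul] at hmain
  have hmain2 := integral_mono hTG (hDi.const_mul (r * C₃ * C₂)) hpt2
  rw [integral_const_mul] at hmain2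
  have hQ : 0 ≤ ∫ w, nearInd z δ w * expSq s w ∂ν :=
    integral_nonneg fun w => mul_nonneg (nearInd_nonneg z δ w) (expSq_pos s w).le
  have hh := mul_le_mul_of_nonneg_right (hhalf a μ ν h) hQ
  have hb1 : r * C₁ * C₂ * ∫ q, domFun s₂ a q ∂(μ.prod ν) ≤ r * C₁ * C₂ * I := by gcongr
  have hb2 : r * C₃ * C₂ * ∫ q, domFun s₂ a q ∂(μ.prod ν) ≤ r * C₃ * C₂ * I := by gcongr
  have hrle : r ≤ (1 + c) * (δ + a) := by rw [hr]; nlinarith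
  calc ∫ w, nearInd z δ w * expSq s w ∂ν ≤ 2 * ((C₁ + C₃) * C₂ * I) * r := by linarith
    _ ≤ 2 * ((C₁ + C₃) * C₂ * I) * ((1 + c) * (δ + a)) := by gcongr
    _ = _ := by ring
lemma measurable_nearInd_prod (z a : ℝ) :
    Measurable fun q : ℝ × ℝ => nearInd z |a * q.1| q.2 := by
  unfold nearInd
  exact Measurable.ite (measurableSet_le (by fun_prop) (by fun_prop)) measurable_const
    measurable_const

/-- The contribution of the discontinuity of the half-line indicator. -/
lemma exists_integral_nearInd_le {b β : ℝ} (hβ : 0 ≤ β) (hb : β < b) :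
    ∃ C : ℝ, 0 < C ∧ ∀ (a : ℝ) (μ ν : Measure ℝ) [IsProbabilityMeasure μ]
      [IsProbabilityMeasure ν], LeaveOneOut b a μ ν → ∀ z : ℝ,
      Integrable (fun q : ℝ × ℝ =>
        (1 + q.1 ^ 2) * ((1 + |z|) * (nearInd z |a * q.1| q.2 * expSq β q.2))) (μ.prod ν) ∧
      ∫ q, (1 + q.1 ^ 2) * ((1 + |z|) * (nearInd z |a * q.1| q.2 * expSq β q.2)) ∂(μ.prod ν)
        ≤ C * a := by
  obtain ⟨s, hβs, hsb⟩ := exists_between hb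
  obtain ⟨s', hss', hs'b⟩ := exists_between hsb
  have hs : 0 ≤ s := hβ.trans hβs.le
  obtain ⟨C₁, hC₁, h₁⟩ := exists_concentration hs hsb
  obtain ⟨C₂, hC₂, h₂⟩ := pow_mul_expSq_le hβs 1
  obtain ⟨C₃, hC₃, h₃⟩ := exists_integral_pow_le b 4
  obtain ⟨C₄, hC₄, h₄⟩ := pow_mul_le_domFun hss' 3
  refine ⟨C₂ * C₁ * C₃, by positivity, fun a μ ν _ _ h z => ?_⟩
  have ha := h.a_pos
  have ha1 := h.a_le_one
  have hmn := measurable_nearInd_prod z a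
  have hme := measurable_expSq s
  have hmb := measurable_expSq β
  set F : ℝ × ℝ → ℝ := fun q => (1 + |q.1|) ^ 3 * (C₂ * (nearInd z |a * q.1| q.2 * expSq s q.2))
    with hF
  have hFm : Measurable F := by fun_prop
  have hFi : Integrable F (μ.prod ν) := by
    refine h.integrable_of_le (hs.trans hss'.le) hs'b hFm (K := C₂ * C₄) fun q => ?_
    have e := expSq_pos s q.2
    have e' := expSq_pos s (q.2 + a * q.1)
    have n0 := nearInd_nonneg z |a * q.1| q.2
    have n1 := nearInd_le_one z |a * q.1| q.2
    rw [abs_of_nonneg (by positivity)]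
    calc F q ≤ (1 + |q.1|) ^ 3 * (C₂ * (1 * (expSq s q.2 + expSq s (q.2 + a * q.1)))) := by
          simp only [hF]
          gcongr
          linarith
      _ = C₂ * ((1 + |q.1|) ^ 3 * (expSq s q.2 + expSq s (q.2 + a * q.1))) := by ring
      _ ≤ C₂ * (C₄ * domFun s' a q) := by
          have := h₄ a q.1 q.2
          gcongr
      _ = _ := by ring
  have hpt : ∀ q : ℝ × ℝ,
      (1 + q.1 ^ 2) * ((1 + |z|) * (nearInd z |a * q.1| q.2 * expSq β q.2)) ≤ F q := by
    rintro ⟨x, w⟩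
    simp only [hF]
    have eβ := expSq_pos β w
    have e := expSq_pos s w
    have hx := abs_nonneg x
    by_cases hn : |w - z| ≤ |a * x|
    · rw [nearInd, if_pos hn, one_mul, one_mul]
      have hzle : 1 + |z| ≤ (1 + |x|) * (1 + |w|) := by
        have t1 : |z| ≤ |w| + |w - z| := by
          have := abs_sub_abs_le_abs_sub z w
          rw [abs_sub_comm z w] at this
          linarith
        have t2 : |a * x| ≤ |x| := by
          rw [abs_mul, abs_of_pos ha]; nlinarith
        nlinarith [mul_nonneg hx (abs_nonneg w)]
      calc (1 + x ^ 2) * ((1 + |z|) * expSq β w)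
          ≤ (1 + |x|) ^ 2 * (((1 + |x|) * (1 + |w|)) * expSq β w) := by
            gcongr
            rw [← sq_abs x]
            nlinarith
        _ = (1 + |x|) ^ 3 * ((1 + |w|) ^ 1 * expSq β w) := by ring
        _ ≤ _ := by
            have := h₂ w
            gcongr
    · rw [nearInd, if_neg hn]
      simp
  have h_int : Integrable (fun q : ℝ × ℝ =>
      (1 + q.1 ^ 2) * ((1 + |z|) * (nearInd z |a * q.1| q.2 * expSq β q.2))) (μ.prod ν) := by
    refine hFi.mono' (by fun_prop) (ae_of_all _ fun q => ?_)
    rw [Real.norm_eq_abs, abs_of_nonneg]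
    · exact hpt q
    · have e := expSq_pos β q.2
      have n0 := nearInd_nonneg z |a * q.1| q.2
      positivity
  refine ⟨h_int, (integral_mono h_int hFi hpt).trans ?_⟩
  rw [integral_prod _ hFi]
  have hinner : ∀ x : ℝ, ∫ w, F (x, w) ∂ν ≤ C₂ * C₁ * a * (1 + |x|) ^ 4 := by
    intro x
    simp only [hF]
    rw [integral_const_mul, integral_const_mul]
    calc (1 + |x|) ^ 3 * (C₂ * ∫ w, nearInd z |a * x| w * expSq s w ∂ν)
        ≤ (1 + |x|) ^ 3 * (C₂ * (C₁ * (|a * x| + a))) := by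
          have := h₁ a μ ν h z |a * x| (abs_nonneg _)
          gcongr
      _ = _ := by rw [abs_mul, abs_of_pos ha]; ring
  have h4i : Integrable (fun x : ℝ => (1 + |x|) ^ 4) μ :=
    h.integrable_pow (by fun_prop) 4 fun x => by rw [abs_of_nonneg (by positivity)]
  calc ∫ x, ∫ w, F (x, w) ∂ν ∂μ ≤ ∫ x, C₂ * C₁ * a * (1 + |x|) ^ 4 ∂μ :=
        integral_mono hFi.integral_prod_left (h4i.const_mul _) hinner
    _ = C₂ * C₁ * a * ∫ x, (1 + |x|) ^ 4 ∂μ := integral_const_mul _ _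
    _ ≤ C₂ * C₁ * a * C₃ := by
        have := h₃ a μ ν h
        gcongr
    _ = _ := by ring

/-- Stein's method for the weighted half-line indicator. -/
theorem exists_abs_integral_centredInd_le {b β : ℝ} (hβ0 : 0 ≤ β) (hβ : β < 1) (hb : β < b) :
    ∃ C : ℝ, 0 < C ∧ ∀ (a : ℝ) (μ ν : Measure ℝ) [IsProbabilityMeasure μ]
      [IsProbabilityMeasure ν], LeaveOneOut b a μ ν → ∀ z : ℝ,
      (1 + |z|) * |∫ q, centredInd β z (q.2 + a * q.1) * expSq β (q.2 + a * q.1) ∂(μ.prod ν)|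
        ≤ C * a := by
  obtain ⟨s, hβs, hsb⟩ := exists_between hb
  obtain ⟨s', hss', hs'b⟩ := exists_between hsb
  have hs : 0 ≤ s := hβ0.trans hβs.le
  have hs' : 0 ≤ s' := hs.trans hss'.le
  obtain ⟨C₁, hC₁, h₁⟩ := exists_integral_nearInd_le hβ0 hb
  obtain ⟨C₂, hC₂, h₂⟩ := abs_steinSol_taylor_le hβ0 hβ hβs
  obtain ⟨C₃, hC₃, h₃⟩ := pow_mul_le_domFun hss' 3
  obtain ⟨I, hI, hdom⟩ := exists_integral_domFun_le hs' hs'b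
  obtain ⟨C₄, hC₄, h₄⟩ := abs_steinSol_le hβ
  obtain ⟨C₅, hC₅, h₅⟩ := abs_steinDeriv_le hβ
  obtain ⟨C₆, hC₆, h₆⟩ := pow_mul_expSq_le hβs 1
  refine ⟨C₂ * C₃ * I + C₁, by positivity, fun a μ ν _ _ h z => ?_⟩
  obtain ⟨hDi, hDI⟩ := hdom a μ ν h
  obtain ⟨hNi, hNI⟩ := h₁ a μ ν h z
  have ha := h.a_pos
  have hz : 0 < 1 + |z| := by positivity
  have hz1 : 1 ≤ 1 + |z| := by linarith [abs_nonneg z]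
  have hGc := continuous_steinSol hβ z
  have hGm := hGc.measurable
  have hDm := measurable_steinDeriv hβ z
  have hGb : ∀ w, |steinSol β z w| ≤ C₄ * expSq β w := fun w =>
    (le_mul_of_one_le_left (abs_nonneg _) hz1).trans (h₄ z w)
  have hDb : ∀ w, |steinDeriv β z w| ≤ C₅ * C₆ * expSq s w := fun w =>
    calc |steinDeriv β z w| ≤ (1 + |z|) * |steinDeriv β z w| :=
          le_mul_of_one_le_left (abs_nonneg _) hz1
      _ ≤ C₅ * ((1 + |w|) ^ 1 * expSq β w) := by rw [pow_one]; exact h₅ z w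
      _ ≤ C₅ * (C₆ * expSq s w) := by
          have := h₆ w
          gcongr
      _ = _ := by ring
  have hWGb : ∀ w, |w * steinSol β z w| ≤ C₄ * C₆ * expSq s w := fun w => by
    rw [abs_mul]
    have e := expSq_pos β w
    have hw := abs_nonneg w
    calc |w| * |steinSol β z w| ≤ (1 + |w|) ^ 1 * (C₄ * expSq β w) := by
          have := hGb w
          have : |w| ≤ (1 + |w|) ^ 1 := by linarith
          gcongr
      _ = C₄ * ((1 + |w|) ^ 1 * expSq β w) := by ring
      _ ≤ C₄ * (C₆ * expSq s w) := by
          have := h₆ w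
          gcongr
      _ = _ := by ring
  obtain ⟨hXG', hXG⟩ := h.integrable_mul hβ0 hb hGm measurable_id 1 hGb
    (fun x => by simp)
  obtain ⟨hD', hD⟩ := h.integrable_mul hs hsb hDm (p := fun _ => 1) measurable_const 0 hDb
    (by simp)
  have hX2D' := (h.integrable_mul hs hsb hDm (p := fun x => x ^ 2) (by fun_prop) 2 hDb
    (fun x => abs_pow_le_one_add_pow x 2)).1
  have hTG := (h.integrable_mul hs hsb (f := fun w => w * steinSol β z w) (p := fun _ => 1)
    (by fun_prop) measurable_const 0 hWGb (by simp)).2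
  simp only [id, one_mul] at hXG' hXG hD' hD hTG
  have hzero : ∫ q : ℝ × ℝ, q.1 * steinSol β z q.2 ∂(μ.prod ν) = 0 := by
    rw [integral_prod_mul (fun x : ℝ => x) (steinSol β z), h.mean_zero, zero_mul]
  have hvar : ∫ q : ℝ × ℝ, q.1 ^ 2 * steinDeriv β z q.2 ∂(μ.prod ν)
      = ∫ q : ℝ × ℝ, steinDeriv β z q.2 ∂(μ.prod ν) := by
    rw [integral_prod_mul (fun x : ℝ => x ^ 2) (steinDeriv β z), h.variance_one, one_mul,
      integral_fun_snd]
    simp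
  set R : ℝ × ℝ → ℝ := fun q => (steinDeriv β z (q.2 + a * q.1) - steinDeriv β z q.2)
    - a⁻¹ * (q.1 * steinSol β z (q.2 + a * q.1) - q.1 * steinSol β z q.2)
    + q.1 ^ 2 * steinDeriv β z q.2 with hR
  have hR_eq : ∫ q, centredInd β z (q.2 + a * q.1) * expSq β (q.2 + a * q.1) ∂(μ.prod ν)
      = ∫ q, R q ∂(μ.prod ν) := by
    have e1 : ∫ q, R q ∂(μ.prod ν)
        = (∫ q : ℝ × ℝ, steinDeriv β z (q.2 + a * q.1) ∂(μ.prod ν))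
          - a⁻¹ * ∫ q : ℝ × ℝ, q.1 * steinSol β z (q.2 + a * q.1) ∂(μ.prod ν) := by
      have i1 : Integrable (fun q : ℝ × ℝ =>
          steinDeriv β z (q.2 + a * q.1) - steinDeriv β z q.2) (μ.prod ν) := hD.sub hD'
      have i2 : Integrable (fun q : ℝ × ℝ => a⁻¹ *
          (q.1 * steinSol β z (q.2 + a * q.1) - q.1 * steinSol β z q.2)) (μ.prod ν) :=
        (hXG.sub hXG').const_mul a⁻¹
      have i3 : Integrable (fun q : ℝ × ℝ =>
          (steinDeriv β z (q.2 + a * q.1) - steinDeriv β z q.2) - a⁻¹ *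
          (q.1 * steinSol β z (q.2 + a * q.1) - q.1 * steinSol β z q.2)) (μ.prod ν) := i1.sub i2
      simp only [hR]
      rw [integral_add i3 hX2D', integral_sub i1 i2, integral_sub hD hD',
        integral_const_mul, integral_sub hXG hXG', hzero, hvar]
      ring
    rw [e1, ← h.integral_sum_mul _ hGc hXG, ← integral_sub hD hTG]
    refine integral_congr_ae (ae_of_all _ fun q => ?_)
    simp only [steinDeriv]
    ring
  have hpt : ∀ q : ℝ × ℝ, (1 + |z|) * |R q| ≤ C₂ * C₃ * a * domFun s' a q
      + (1 + q.1 ^ 2) * ((1 + |z|) * (nearInd z |a * q.1| q.2 * expSq β q.2)) := by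
    rintro ⟨x, w⟩
    obtain ⟨t1, t2⟩ := h₂ z w (a * x)
    set B := C₂ * (|a * x| * (expSq s w + expSq s (w + a * x)))
      + (1 + |z|) * (nearInd z |a * x| w * expSq β w) with hB
    have hRle : |R (x, w)| ≤ |steinDeriv β z (w + a * x) - steinDeriv β z w|
        + a⁻¹ * |x| * |steinSol β z (w + a * x) - steinSol β z w
            - a * x * steinDeriv β z w| := by
      have : R (x, w) = (steinDeriv β z (w + a * x) - steinDeriv β z w)
          + (-(a⁻¹ * x)) * (steinSol β z (w + a * x) - steinSol β z w
            - a * x * steinDeriv β z w) := by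
        simp only [hR]
        field_simp
        ring
      rw [this]
      refine (abs_add_le _ _).trans (le_of_eq ?_)
      rw [abs_mul, abs_neg, abs_mul, abs_of_pos (inv_pos.2 ha)]
    have hx := abs_nonneg x
    have e1 := expSq_pos s w
    have e2 := expSq_pos s (w + a * x)
    calc (1 + |z|) * |R (x, w)|
        ≤ (1 + |z|) * (|steinDeriv β z (w + a * x) - steinDeriv β z w|
          + a⁻¹ * |x| * |steinSol β z (w + a * x) - steinSol β z w
            - a * x * steinDeriv β z w|) := by gcongr
      _ = (1 + |z|) * |steinDeriv β z (w + a * x) - steinDeriv β z w|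
          + a⁻¹ * |x| * ((1 + |z|) * |steinSol β z (w + a * x) - steinSol β z w
            - a * x * steinDeriv β z w|) := by ring
      _ ≤ B + a⁻¹ * |x| * (|a * x| * B) := by gcongr
      _ = (1 + x ^ 2) * B := by
          rw [abs_mul, abs_of_pos ha, ← sq_abs x]
          field_simp
      _ = C₂ * a * (((1 + x ^ 2) * |x|) * (expSq s w + expSq s (w + a * x)))
          + (1 + x ^ 2) * ((1 + |z|) * (nearInd z |a * x| w * expSq β w)) := by
          rw [hB, abs_mul, abs_of_pos ha]; ring
      _ ≤ C₂ * a * ((1 + |x|) ^ 3 * (expSq s w + expSq s (w + a * x)))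
          + (1 + x ^ 2) * ((1 + |z|) * (nearInd z |a * x| w * expSq β w)) := by
          have : (1 + x ^ 2) * |x| ≤ (1 + |x|) ^ 3 := by
            rw [← sq_abs x]; nlinarith
          gcongr
      _ ≤ C₂ * a * (C₃ * domFun s' a (x, w))
          + (1 + x ^ 2) * ((1 + |z|) * (nearInd z |a * x| w * expSq β w)) := by
          have := h₃ a x w
          gcongr
      _ = _ := by ring
  have hRi : Integrable R (μ.prod ν) :=
    ((hD.sub hD').sub ((hXG.sub hXG').const_mul a⁻¹)).add hX2D'
  rw [hR_eq]
  calc (1 + |z|) * |∫ q, R q ∂(μ.prod ν)| ≤ (1 + |z|) * ∫ q, |R q| ∂(μ.prod ν) := by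
        gcongr
        exact abs_integral_le_integral_abs
    _ = ∫ q, (1 + |z|) * |R q| ∂(μ.prod ν) := (integral_const_mul _ _).symm
    _ ≤ ∫ q, (C₂ * C₃ * a * domFun s' a q
      + (1 + q.1 ^ 2) * ((1 + |z|) * (nearInd z |a * q.1| q.2 * expSq β q.2))) ∂(μ.prod ν) :=
        integral_mono (hRi.abs.const_mul _) ((hDi.const_mul _).add hNi) hpt
    _ = C₂ * C₃ * a * (∫ q, domFun s' a q ∂(μ.prod ν))
      + ∫ q, (1 + q.1 ^ 2) * ((1 + |z|) * (nearInd z |a * q.1| q.2 * expSq β q.2)) ∂(μ.prod ν) := by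
        rw [integral_add (hDi.const_mul _) hNi, integral_const_mul]
    _ ≤ C₂ * C₃ * a * I + C₁ * a := by gcongr
    _ = _ := by ring

/-- The law of `a * (y₁ + ⋯ + yₘ)` for independent `yᵢ` with law `L`. -/
noncomputable def scaledSumLaw (L : Measure ℝ) (m : ℕ) (a : ℝ) : Measure ℝ :=
  (Measure.pi fun _ : Fin m => L).map fun y => a * ∑ j, y j

lemma measurable_mul_sum (m : ℕ) (a : ℝ) : Measurable fun y : Fin m → ℝ => a * ∑ j, y j := by
  fun_prop

instance (L : Measure ℝ) [IsProbabilityMeasure L] (m : ℕ) (a : ℝ) :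
    IsProbabilityMeasure (scaledSumLaw L m a) :=
  Measure.isProbabilityMeasure_map (measurable_mul_sum m a).aemeasurable

lemma measurePreserving_splitSum (L : Measure ℝ) [IsProbabilityMeasure L] (m : ℕ) (a : ℝ)
    (i : Fin (m + 1)) :
    MeasurePreserving (fun x : Fin (m + 1) → ℝ => (x i, a * ∑ j, x (i.succAbove j)))
      (Measure.pi fun _ => L) (L.prod (scaledSumLaw L m a)) :=
  ((MeasurePreserving.id L).prod ⟨measurable_mul_sum m a, rfl⟩).comp
    (measurePreserving_piFinSuccAbove (fun _ => L) i)

lemma splitSum_add (m : ℕ) (a : ℝ) (i : Fin (m + 1)) (x : Fin (m + 1) → ℝ) :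
    a * ∑ j, x (i.succAbove j) + a * x i = a * ∑ j, x j := by
  rw [Fin.sum_univ_succAbove x i]; ring

lemma lintegral_exp_mul_sum_le {L : Measure ℝ} [IsProbabilityMeasure L] {b a : ℝ} (hb : 0 < b)
    (h_int : ∀ t : ℝ, Integrable (fun x : ℝ => Real.exp (t * x)) L)
    (hexp : ∀ t : ℝ, (∫ x : ℝ, Real.exp (t * x) ∂L) ≤ Real.exp (t ^ 2 / (2 * b)))
    (k : ℕ) (hk : k * a ^ 2 ≤ 1) (t : ℝ) :
    ∫⁻ x, ENNReal.ofReal (Real.exp (t * (a * ∑ i, x i))) ∂(Measure.pi fun _ : Fin k => L) ≤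
      ENNReal.ofReal (Real.exp (t ^ 2 / (2 * b))) := by
  have hprod (x : Fin k → ℝ) :
      Real.exp (t * (a * ∑ i, x i)) = ∏ i, Real.exp (t * a * x i) := by
    rw [← Real.exp_sum, ← Finset.mul_sum, mul_assoc]
  simp_rw [hprod]
  rw [← ofReal_integral_eq_lintegral_ofReal
    (Integrable.fintype_prod (μ := fun _ : Fin k => L) fun _ => h_int (t * a))
    (Filter.Eventually.of_forall fun x => Finset.prod_nonneg fun i _ => (Real.exp_pos _).le),
    integral_fintype_prod_eq_pow (fun y : ℝ => Real.exp (t * a * y)), Fintype.card_fin]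
  refine ENNReal.ofReal_le_ofReal ?_
  calc (∫ x, Real.exp (t * a * x) ∂L) ^ k ≤ Real.exp ((t * a) ^ 2 / (2 * b)) ^ k :=
        pow_le_pow_left₀ (integral_nonneg fun _ => (Real.exp_pos _).le) (hexp _) _
    _ = Real.exp (k * a ^ 2 * (t ^ 2 / (2 * b))) := by
        rw [← Real.exp_nat_mul]; congr 1; ring
    _ ≤ Real.exp (t ^ 2 / (2 * b)) :=
        Real.exp_le_exp.2 (mul_le_of_le_one_left (by positivity) hk)

lemma integral_comp_splitSum {L : Measure ℝ} [IsProbabilityMeasure L] (m : ℕ) (a : ℝ)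
    (i : Fin (m + 1)) {f : ℝ × ℝ → ℝ} (hf : Measurable f) :
    ∫ x, f (x i, a * ∑ j, x (i.succAbove j)) ∂(Measure.pi fun _ => L) =
      ∫ q, f q ∂(L.prod (scaledSumLaw L m a)) := by
  have h := measurePreserving_splitSum L m a i
  rw [← h.map_eq, integral_map h.measurable.aemeasurable hf.aestronglyMeasurable]

lemma leaveOneOut_scaledSumLaw {L : Measure ℝ} [IsProbabilityMeasure L] {b : ℝ} (hb : 0 < b)
    (hmean : ∫ x : ℝ, x ∂L = 0) (hvar : ∫ x : ℝ, x ^ 2 ∂L = 1)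
    (h_int : ∀ t : ℝ, Integrable (fun x : ℝ => Real.exp (t * x)) L)
    (hexp : ∀ t : ℝ, (∫ x : ℝ, Real.exp (t * x) ∂L) ≤ Real.exp (t ^ 2 / (2 * b)))
    (m : ℕ) {a : ℝ} (ha : 0 < a) (ham : (m + 1) * a ^ 2 = 1) :
    LeaveOneOut b a L (scaledSumLaw L m a) where
  a_pos := ha
  a_le_one := by
    have hm : (0 : ℝ) ≤ m := m.cast_nonneg
    nlinarith
  mean_zero := hmean
  variance_one := hvar
  lintegral_exp_fst t := by
    rw [← ofReal_integral_eq_lintegral_ofReal (h_int t)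
      (Filter.Eventually.of_forall fun x => (Real.exp_pos _).le)]
    exact ENNReal.ofReal_le_ofReal (hexp t)
  lintegral_exp_snd t := by
    rw [scaledSumLaw, lintegral_map (by fun_prop) (measurable_mul_sum m a)]
    exact lintegral_exp_mul_sum_le hb h_int hexp m (by nlinarith) t
  lintegral_exp_sum t := by
    rw [← (measurePreserving_splitSum L m a 0).lintegral_comp (by fun_prop)]
    simp_rw [splitSum_add]
    exact lintegral_exp_mul_sum_le hb h_int hexp (m + 1) (by push_cast; exact ham.le) t
  integral_sum_mul G hG hi := by
    have hterm (i : Fin (m + 1)) :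
        ∫ x : Fin (m + 1) → ℝ, x i * G (a * ∑ j, x j) ∂(Measure.pi fun _ => L) =
          ∫ q, q.1 * G (q.2 + a * q.1) ∂(L.prod (scaledSumLaw L m a)) := by
      rw [← integral_comp_splitSum m a i (by fun_prop)]
      simp_rw [splitSum_add]
    have hterm_int (i : Fin (m + 1)) :
        Integrable (fun x : Fin (m + 1) → ℝ => x i * G (a * ∑ j, x j))
          (Measure.pi fun _ => L) := by
      have := (measurePreserving_splitSum L m a i).integrable_comp_of_integrable hi
      simpa only [Function.comp_def, splitSum_add] using this
    rw [← integral_comp_splitSum m a 0 (by fun_prop)]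
    simp_rw [splitSum_add]
    calc ∫ x : Fin (m + 1) → ℝ, a * (∑ j, x j) * G (a * ∑ j, x j) ∂(Measure.pi fun _ => L)
        = ∫ x : Fin (m + 1) → ℝ, a * ∑ i, x i * G (a * ∑ j, x j) ∂(Measure.pi fun _ => L) := by
          simp_rw [mul_assoc, Finset.sum_mul]
      _ = a * ∑ i, ∫ x : Fin (m + 1) → ℝ, x i * G (a * ∑ j, x j) ∂(Measure.pi fun _ => L) := by
          rw [integral_const_mul, integral_finsetSum _ fun i _ => hterm_int i]
      _ = ((m + 1) * a) * ∫ q, q.1 * G (q.2 + a * q.1) ∂(L.prod (scaledSumLaw L m a)) := by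
          simp_rw [hterm]
          rw [Finset.sum_const, Finset.card_univ, Fintype.card_fin, nsmul_eq_mul]
          push_cast; ring
      _ = _ := by
          rw [eq_inv_of_mul_eq_one_left (a := (m + 1) * a) (b := a) (by linear_combination ham)]

lemma abs_toReal_normalized_withDensity_sub_le {Ω : Type*} [MeasurableSpace Ω] (P : Measure Ω)
    [IsProbabilityMeasure P] {h : Ω → ℝ} (hh : Integrable h P) (h1 : ∀ x, 1 ≤ h x)
    {S : Set Ω} (hS : MeasurableSet S) (F : ℝ) :
    |((((P.withDensity fun x => ENNReal.ofReal (h x)) Set.univ)⁻¹ •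
        P.withDensity fun x => ENNReal.ofReal (h x)) S).toReal - F| ≤
      |∫ x, (S.indicator 1 x - F) * h x ∂P| := by
  have h0 (x : Ω) : 0 ≤ h x := zero_le_one.trans (h1 x)
  have hK : 1 ≤ ∫ x, h x ∂P := by
    simpa using integral_mono (integrable_const (1 : ℝ)) hh h1
  rw [Measure.smul_apply, withDensity_apply _ hS, withDensity_apply _ MeasurableSet.univ,
    Measure.restrict_univ,
    ← ofReal_integral_eq_lintegral_ofReal hh (Filter.Eventually.of_forall h0),
    ← ofReal_integral_eq_lintegral_ofReal hh.integrableOn (Filter.Eventually.of_forall h0),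
    smul_eq_mul, ENNReal.toReal_mul, ENNReal.toReal_inv,
    ENNReal.toReal_ofReal (by linarith),
    ENNReal.toReal_ofReal (integral_nonneg h0)]
  have hsplit : ∫ x, (S.indicator 1 x - F) * h x ∂P = (∫ x in S, h x ∂P) - F * ∫ x, h x ∂P := by
    rw [← integral_indicator hS, ← integral_const_mul, ← integral_sub (hh.indicator hS)
      (hh.const_mul F)]
    congr 1 with x
    by_cases hx : x ∈ S <;> simp [hx, sub_mul]
  rw [hsplit]
  set K := ∫ x, h x ∂P
  have : K⁻¹ * (∫ x in S, h x ∂P) - F = K⁻¹ * ((∫ x in S, h x ∂P) - F * K) := by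
    field_simp
  rw [this, abs_mul, abs_of_nonneg (by positivity)]
  exact mul_le_of_le_one_left (abs_nonneg _) (inv_le_one_of_one_le₀ hK)

lemma abs_curieWeiss_sub_cdfN_le {L : Measure ℝ} [IsProbabilityMeasure L] {b β : ℝ}
    (hβ0 : 0 ≤ β) (hb : β < b) {m : ℕ} {a : ℝ} (ha : a = (√(m + 1 : ℕ))⁻¹)
    (hL : LeaveOneOut b a L (scaledSumLaw L m a)) (z : ℝ) :
    |((curieWeiss L (m + 1) β) {x | (∑ i, x i) / √(m + 1 : ℕ) ≤ z}).toReal - cdfN β z| ≤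
      |∫ q, centredInd β z (q.2 + a * q.1) * expSq β (q.2 + a * q.1)
        ∂(L.prod (scaledSumLaw L m a))| := by
  have hdens (x : Fin (m + 1) → ℝ) :
      Real.exp (β * (∑ i, x i) ^ 2 / (2 * (m + 1 : ℕ))) = expSq β (a * ∑ i, x i) := by
    have : a ^ 2 = ((m + 1 : ℕ) : ℝ)⁻¹ := by
      rw [ha, inv_pow, Real.sq_sqrt (Nat.cast_nonneg _)]
    rw [expSq, mul_pow, this]; congr 1; field_simp
  have h_int : Integrable (fun x : Fin (m + 1) → ℝ => expSq β (a * ∑ i, x i))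
      (Measure.pi fun _ => L) := by
    have hi := (hL.integrable_mul hβ0 hb (measurable_expSq β) (p := fun _ => 1) measurable_const
      (K := 1) 0 (fun w => by rw [one_mul, abs_of_pos (expSq_pos _ _)]) (by simp)).2
    have := (measurePreserving_splitSum L m a 0).integrable_comp_of_integrable hi
    simpa only [Function.comp_def, splitSum_add, one_mul] using this
  have hS : MeasurableSet {x : Fin (m + 1) → ℝ | (∑ i, x i) / √(m + 1 : ℕ) ≤ z} :=
    measurableSet_le (by fun_prop) measurable_const
  have key := abs_toReal_normalized_withDensity_sub_le (Measure.pi fun _ : Fin (m + 1) => L) h_int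
    (fun x => one_le_expSq hβ0 _) hS (cdfN β z)
  have hf : Measurable fun q : ℝ × ℝ =>
      centredInd β z (q.2 + a * q.1) * expSq β (q.2 + a * q.1) := by
    have := measurable_centredInd β z
    have := measurable_expSq β
    fun_prop
  rw [← integral_comp_splitSum m a 0 hf]
  simp_rw [splitSum_add]
  convert key using 3
  · simp only [curieWeiss, hdens]
  · congr 1 with x
    congr 1
    simp only [centredInd, ha, Set.indicator_apply, Set.mem_ofPred_eq, div_eq_inv_mul,
      Pi.one_apply]

/-- Non-uniform Berry–Esseen bound for the general Curie–Weiss model, `0 < β < 1`: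
`|P(Wₙ ≤ z) − F₁(z)| ≤ C / ((1 + (1-β)|z|)√n)` with `C` depending only on `b, β`. -/
theorem stmt3 (β b : ℝ) (hβ : β ∈ Set.Ioo (0:ℝ) 1) (hb : β < b) :
    ∃ C : ℝ, 0 < C ∧
      ∀ (L : Measure ℝ) [IsProbabilityMeasure L],
        -- mean `0`, variance `1`
        Integrable (fun x : ℝ => x) L → (∫ x : ℝ, x ∂L) = 0 →
        Integrable (fun x : ℝ => x ^ 2) L → (∫ x : ℝ, x ^ 2 ∂L) = 1 →
        -- the exponential moment condition (3.3)
        (∀ t : ℝ, Integrable (fun x : ℝ => Real.exp (t * x)) L) →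
        (∀ t : ℝ, (∫ x : ℝ, Real.exp (t * x) ∂L) ≤ Real.exp (t ^ 2 / (2 * b))) →
      ∀ n : ℕ, 1 ≤ n →
      ∀ z : ℝ,
        |((curieWeiss L n β) {x | (∑ i, x i) / Real.sqrt n ≤ z}).toReal - cdfN β z| ≤
          C / ((1 + (1 - β) * |z|) * Real.sqrt n) := by
  obtain ⟨C, hC, hmain⟩ := exists_abs_integral_centredInd_le hβ.1.le hβ.2 hb
  refine ⟨C, hC, fun L _ _ hmean _ hvar h_int hexp n hn z => ?_⟩
  obtain ⟨m, rfl⟩ : ∃ m, n = m + 1 := ⟨n - 1, by omega⟩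
  set r : ℝ := √((m + 1 : ℕ) : ℝ) with hr
  have hr0 : 0 < r := Real.sqrt_pos.2 (by positivity)
  have hr2 : (m + 1) * r⁻¹ ^ 2 = (1 : ℝ) := by
    have : r ^ 2 = m + 1 := by rw [hr, Real.sq_sqrt (Nat.cast_nonneg _)]; push_cast; rfl
    rw [← this]; field_simp
  have hL := leaveOneOut_scaledSumLaw (hβ.1.trans hb) hmean hvar h_int hexp m (inv_pos.2 hr0) hr2
  have hz := hmain _ L _ hL z
  have hdiff := abs_curieWeiss_sub_cdfN_le hβ.1.le hb rfl hL z
  have hβ' : 0 ≤ 1 - β := sub_nonneg.2 hβ.2.le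
  have hweight : 1 + (1 - β) * |z| ≤ 1 + |z| := by
    nlinarith [abs_nonneg z, hβ.1]
  refine hdiff.trans ?_
  rw [le_div_iff₀ (by positivity), ← mul_assoc, ← le_div_iff₀ hr0, div_eq_mul_inv, mul_comm]
  exact (mul_le_mul_of_nonneg_right hweight (abs_nonneg _)).trans hz
end

section
/- Let L be a distribution function on ℝ with ∫x dL(x) = 0 and ∫x² dL(x) = 1 which is of type k with some strength λ_ρ (i.e. ∫xʲdΦ(x) − ∫xʲdL(x) = 0 for j = 1,…,2k−1 and equals λ_ρ for j = 2k). Suppose a random variable ξ with law L satisfies E e^{tξ} ≤ exp(t²/2 − b₁t^{2k}) for |t| ≤ b₀ and E e^{tξ} ≤ exp(t²/(2b₂)) for |t| > b₀, for some constants b₀ > 0, b₁ > 0, b₂ > 1. Let (X₁,…,Xₙ) have the Curie–Weiss joint distribution dP_{n,1}(x) = K_n^{-1} exp((x₁+⋯+xₙ)²/(2n)) Π_i dL(x_i) and set Wₙ = (X₁+⋯+Xₙ)/n^{1−1/(2k)}. Let H(s) = s²/2 − ln(∫ e^{sx} dL(x)), c₂ = H^{(2k)}(0)/(2k)!, and let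 F_k be the distribution function with density p_k(y) = c₁ e^{−c₂ y^{2k}}, c₁ being the normalizing constant. Then there is a constant C depending only on b₀, b₁, b₂ and k such that for all z ∈ ℝ: |P(Wₙ ≤ z) − F_k(z)| ≤ C / ((1 + 2k c₂ |z|^{2k−1})·n^{1/(2k)}). -/
open MeasureTheory ProbabilityTheory

/-- The `j`-th moment of the standard normal distribution. -/
noncomputable def stdNormMoment (j : ℕ) : ℝ :=
  ∫ x : ℝ, x ^ j * (Real.exp (-x ^ 2 / 2) / Real.sqrt (2 * Real.pi))

/-- `H(s) = s²/2 - ln ∫ e^{sx} dL(x)`. -/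
noncomputable def Hfun (L : Measure ℝ) (s : ℝ) : ℝ :=
  s ^ 2 / 2 - Real.log (∫ x : ℝ, Real.exp (s * x) ∂L)

theorem abs_mgf_sub_sum_le (μ : Measure ℝ)
    (hint : ∀ t : ℝ, Integrable (fun x : ℝ => Real.exp (t * x)) μ)
    (hb : ∀ t : ℝ, (∫ x : ℝ, Real.exp (t * x) ∂μ) ≤ Real.exp (t ^ 2 / 2))
    (hpow : ∀ j : ℕ, Integrable (fun x : ℝ => x ^ j) μ)
    (N : ℕ) {s : ℝ} (hs : |s| ≤ 1) :
    |(∫ x : ℝ, Real.exp (s * x) ∂μ) -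
      ∑ j ∈ Finset.range N, s ^ j / (j.factorial : ℝ) * ∫ x : ℝ, x ^ j ∂μ| ≤
      2 * (N.factorial : ℝ) * Real.exp 2 * |s| ^ N := by
  have hterm : ∀ j ∈ Finset.range N,
      Integrable (fun x : ℝ => s ^ j / (j.factorial : ℝ) * x ^ j) μ :=
    fun j _ => (hpow j).const_mul _
  have hsum : (∑ j ∈ Finset.range N, s ^ j / (j.factorial : ℝ) * ∫ x : ℝ, x ^ j ∂μ) =
      ∫ x : ℝ, ∑ j ∈ Finset.range N, s ^ j / (j.factorial : ℝ) * x ^ j ∂μ := by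
    rw [integral_finsetSum _ hterm]
    simp only [integral_const_mul]
  rw [hsum, ← integral_sub (hint s) (integrable_finsetSum _ hterm)]
  have hpt : ∀ x : ℝ,
      ‖Real.exp (s * x) - ∑ j ∈ Finset.range N, s ^ j / (j.factorial : ℝ) * x ^ j‖ ≤
        (N.factorial : ℝ) * |s| ^ N * (Real.exp (2 * x) + Real.exp (-2 * x)) := by
    intro x
    have h1 := Complex.norm_exp_sub_sum_le_norm_mul_exp ((s * x : ℝ) : ℂ) N
    have h2 : Complex.exp ((s * x : ℝ) : ℂ) -
        ∑ m ∈ Finset.range N, ((s * x : ℝ) : ℂ) ^ m / (m.factorial : ℂ) =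
        ((Real.exp (s * x) -
          ∑ j ∈ Finset.range N, s ^ j / (j.factorial : ℝ) * x ^ j : ℝ) : ℂ) := by
      push_cast
      congr 1
      refine Finset.sum_congr rfl fun j _ => ?_
      rw [mul_pow]
      ring
    rw [h2, Complex.norm_real, Complex.norm_real, Real.norm_eq_abs (s * x), abs_mul,
      mul_pow] at h1
    refine h1.trans ?_
    have h3 : |x| ^ N ≤ (N.factorial : ℝ) * Real.exp |x| := by
      have := Real.pow_div_factorial_le_exp |x| (abs_nonneg x) N
      rwa [div_le_iff₀ (by positivity), mul_comm] at this
    have h4 : Real.exp (|s| * |x|) ≤ Real.exp |x| :=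
      Real.exp_le_exp.2 (mul_le_of_le_one_left (abs_nonneg x) hs)
    have h5 : Real.exp |x| * Real.exp |x| ≤ Real.exp (2 * x) + Real.exp (-2 * x) := by
      rw [← Real.exp_add]
      rcases abs_cases x with ⟨h, _⟩ | ⟨h, _⟩
      · rw [h, show x + x = 2 * x by ring]
        linarith [Real.exp_pos (-2 * x)]
      · rw [h, show -x + -x = -2 * x by ring]
        linarith [Real.exp_pos (2 * x)]
    calc |s| ^ N * |x| ^ N * Real.exp (|s| * |x|)
        ≤ |s| ^ N * ((N.factorial : ℝ) * Real.exp |x|) * Real.exp |x| := by gcongr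
      _ = (N.factorial : ℝ) * |s| ^ N * (Real.exp |x| * Real.exp |x|) := by ring
      _ ≤ _ := by gcongr
  have hI : Integrable (fun x : ℝ =>
      (N.factorial : ℝ) * |s| ^ N * (Real.exp (2 * x) + Real.exp (-2 * x))) μ :=
    ((hint 2).add (hint (-2))).const_mul _
  have := norm_integral_le_of_norm_le hI (ae_of_all _ hpt)
  rw [Real.norm_eq_abs] at this
  refine this.trans ?_
  rw [integral_const_mul, integral_add (hint 2) (hint (-2))]
  have e1 := hb 2
  have e2 := hb (-2)
  norm_num at e1 e2
  calc (N.factorial : ℝ) * |s| ^ N *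
        ((∫ x : ℝ, Real.exp (2 * x) ∂μ) + ∫ x : ℝ, Real.exp (-2 * x) ∂μ)
      ≤ (N.factorial : ℝ) * |s| ^ N * (Real.exp 2 + Real.exp 2) := by
        gcongr
        simpa using e2
    _ = _ := by ring

theorem integrable_pow_of_integrable_exp (μ : Measure ℝ)
    (hint : ∀ t : ℝ, Integrable (fun x : ℝ => Real.exp (t * x)) μ) (j : ℕ) :
    Integrable (fun x : ℝ => x ^ j) μ :=
  integrable_pow_of_integrable_exp_mul (X := fun x : ℝ => x) (t := 1) one_ne_zero
    (hint 1) (hint (-1)) j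

theorem stdNormMoment_eq (j : ℕ) :
    stdNormMoment j = ∫ x : ℝ, x ^ j ∂(gaussianReal 0 1) := by
  rw [integral_gaussianReal_eq_integral_smul one_ne_zero]
  unfold stdNormMoment gaussianPDFReal
  refine integral_congr_ae (ae_of_all _ fun x => ?_)
  simp
  ring

theorem abs_mgf_sub_exp_le (L : Measure ℝ) [IsProbabilityMeasure L] (k : ℕ)
    (hint : ∀ t : ℝ, Integrable (fun x : ℝ => Real.exp (t * x)) L)
    (hb : ∀ t : ℝ, (∫ x : ℝ, Real.exp (t * x) ∂L) ≤ Real.exp (t ^ 2 / 2))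
    (hmom : ∀ j : ℕ, 1 ≤ j → j ≤ 2 * k - 1 → stdNormMoment j - (∫ x : ℝ, x ^ j ∂L) = 0)
    {s : ℝ} (hs : |s| ≤ 1) :
    |(∫ x : ℝ, Real.exp (s * x) ∂L) - Real.exp (s ^ 2 / 2) +
      (stdNormMoment (2 * k) - ∫ x : ℝ, x ^ (2 * k) ∂L) / ((2 * k).factorial : ℝ) *
        s ^ (2 * k)| ≤
      4 * ((2 * k + 1).factorial : ℝ) * Real.exp 2 * |s| ^ (2 * k + 1) := by
  have hgm : ∀ t : ℝ, (∫ x : ℝ, Real.exp (t * x) ∂(gaussianReal 0 1)) = Real.exp (t ^ 2 / 2) := by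
    intro t
    have := congrFun (mgf_id_gaussianReal (μ := 0) (v := 1)) t
    simpa [mgf] using this
  have hgi : ∀ t : ℝ, Integrable (fun x : ℝ => Real.exp (t * x)) (gaussianReal 0 1) :=
    fun t => integrable_exp_mul_gaussianReal t
  have h1 := abs_mgf_sub_sum_le L hint hb (integrable_pow_of_integrable_exp L hint) (2 * k + 1) hs
  have h2 := abs_mgf_sub_sum_le (gaussianReal 0 1) hgi (fun t => (hgm t).le)
    (integrable_pow_of_integrable_exp _ hgi) (2 * k + 1) hs
  rw [hgm] at h2
  simp only [← stdNormMoment_eq] at h2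
  have hlow : (∑ j ∈ Finset.range (2 * k), s ^ j / (j.factorial : ℝ) * stdNormMoment j) =
      ∑ j ∈ Finset.range (2 * k), s ^ j / (j.factorial : ℝ) * ∫ x : ℝ, x ^ j ∂L := by
    refine Finset.sum_congr rfl fun j hj => ?_
    rw [Finset.mem_range] at hj
    rcases Nat.eq_zero_or_pos j with rfl | hj0
    · simp [stdNormMoment_eq]
    · rw [sub_eq_zero.1 (hmom j hj0 (by omega))]
  rw [Finset.sum_range_succ] at h1 h2
  rw [hlow] at h2
  rw [abs_le] at *
  constructor
  · have : (stdNormMoment (2 * k) - ∫ x : ℝ, x ^ (2 * k) ∂L) / ((2 * k).factorial : ℝ) *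
        s ^ (2 * k) = s ^ (2 * k) / ((2 * k).factorial : ℝ) * stdNormMoment (2 * k) -
        s ^ (2 * k) / ((2 * k).factorial : ℝ) * ∫ x : ℝ, x ^ (2 * k) ∂L := by ring
    linarith [h1.1, h2.2]
  · have : (stdNormMoment (2 * k) - ∫ x : ℝ, x ^ (2 * k) ∂L) / ((2 * k).factorial : ℝ) *
        s ^ (2 * k) = s ^ (2 * k) / ((2 * k).factorial : ℝ) * stdNormMoment (2 * k) -
        s ^ (2 * k) / ((2 * k).factorial : ℝ) * ∫ x : ℝ, x ^ (2 * k) ∂L := by ring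
    linarith [h1.2, h2.1]

theorem one_le_mgf (L : Measure ℝ) [IsProbabilityMeasure L]
    (hi : Integrable (fun x : ℝ => x) L) (h0 : (∫ x : ℝ, x ∂L) = 0)
    (hint : ∀ t : ℝ, Integrable (fun x : ℝ => Real.exp (t * x)) L) (t : ℝ) :
    1 ≤ ∫ x : ℝ, Real.exp (t * x) ∂L := by
  have h : (∫ x : ℝ, (t * x + 1) ∂L) = 1 := by
    rw [integral_add (hi.const_mul t) (integrable_const _), integral_const_mul, h0]
    simp
  rw [← h]
  exact integral_mono ((hi.const_mul t).add (integrable_const _)) (hint t)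
    fun x => Real.add_one_le_exp (t * x)

theorem abs_half_sq_sub_log_sub_le {k : ℕ} (hk : 1 ≤ k) {M lam Λ D s : ℝ} (hD : 0 ≤ D)
    (hlam : |lam| ≤ Λ) (hM1 : 1 ≤ M) (hM2 : M ≤ Real.exp (s ^ 2 / 2))
    (hexp : |s| ≤ 1 →
      |M - Real.exp (s ^ 2 / 2) + lam * s ^ (2 * k)| ≤ D * |s| ^ (2 * k + 1)) :
    |s ^ 2 / 2 - Real.log M - lam * s ^ (2 * k)| ≤
      (D + 2 * Λ + 1 + 2 * (D + Λ) ^ 2) * |s| ^ (2 * k + 1) := by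
  have hΛ : 0 ≤ Λ := (abs_nonneg lam).trans hlam
  have hu : s ^ (2 * k) = |s| ^ (2 * k) := by rw [pow_mul, pow_mul, sq_abs]
  have hs2 : s ^ 2 = |s| ^ 2 := (sq_abs s).symm
  have hMpos : 0 < M := by linarith
  have hlu : |lam * s ^ (2 * k)| ≤ Λ * |s| ^ (2 * k) := by
    rw [abs_mul, hu, abs_of_nonneg (pow_nonneg (abs_nonneg s) _)]
    gcongr
  rcases le_or_gt |s| 1 with hs | hs
  · have hρ := hexp hs
    have hmono : ∀ i j : ℕ, i ≤ j → |s| ^ j ≤ |s| ^ i := fun i j hij =>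
      pow_le_pow_of_le_one (abs_nonneg s) hs hij
    set E := Real.exp (s ^ 2 / 2) with hE
    have hE1 : 1 + s ^ 2 / 2 ≤ E := by linarith [Real.add_one_le_exp (s ^ 2 / 2)]
    have hEpos : 0 < E := Real.exp_pos _
    have hE1' : 1 ≤ E := by nlinarith [sq_nonneg s]
    have hE2 : E ≤ 2 := by
      have h1 : s ^ 2 / 2 ≤ 1 / 2 := by rw [hs2]; nlinarith [abs_nonneg s]
      have h2 : E ≤ Real.exp (1 / 2) := Real.exp_le_exp.2 h1
      have h3 : Real.exp (1 / 2) ^ 2 = Real.exp 1 := by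
        rw [← Real.exp_nat_mul]; norm_num
      nlinarith [Real.exp_one_lt_d9, Real.exp_pos (1 / 2)]
    have hEinv : 1 - 1 / E ≤ s ^ 2 / 2 := by
      have : Real.exp (-(s ^ 2 / 2)) = 1 / E := by rw [Real.exp_neg, one_div]
      rw [← this]
      linarith [Real.add_one_le_exp (-(s ^ 2 / 2))]
    have hEinv0 : 0 ≤ 1 - 1 / E := by
      rw [sub_nonneg, div_le_one hEpos]; exact hE1'
    set x := (M - E) / E with hx
    have hx1 : 1 + x = M / E := by rw [hx]; field_simp; ring
    have hxhalf : 1 / 2 ≤ 1 + x := by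
      rw [hx1, div_le_div_iff₀ two_pos hEpos]; linarith
    have hlog : s ^ 2 / 2 - Real.log M = -Real.log (1 + x) := by
      rw [hx1, Real.log_div hMpos.ne' hEpos.ne', hE, Real.log_exp]; ring
    have hME : |M - E| ≤ (D + Λ) * |s| ^ (2 * k) := by
      calc |M - E| = |(M - E + lam * s ^ (2 * k)) - lam * s ^ (2 * k)| := by ring_nf
        _ ≤ |M - E + lam * s ^ (2 * k)| + |lam * s ^ (2 * k)| := abs_sub _ _
        _ ≤ D * |s| ^ (2 * k + 1) + Λ * |s| ^ (2 * k) := add_le_add hρ hlu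
        _ ≤ D * |s| ^ (2 * k) + Λ * |s| ^ (2 * k) := by
            gcongr ?_ * ?_ + _
            exact hmono _ _ (Nat.le_succ _)
        _ = _ := by ring
    have hxabs : |x| ≤ (D + Λ) * |s| ^ (2 * k) := by
      rw [hx, abs_div, abs_of_pos hEpos]
      exact (div_le_self (abs_nonneg _) hE1').trans hME
    have hx2 : x ^ 2 ≤ (D + Λ) ^ 2 * |s| ^ (2 * k + 1) := by
      calc x ^ 2 = |x| ^ 2 := (sq_abs x).symm
        _ ≤ ((D + Λ) * |s| ^ (2 * k)) ^ 2 := by gcongr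
        _ = (D + Λ) ^ 2 * |s| ^ (2 * k * 2) := by rw [mul_pow, ← pow_mul]
        _ ≤ _ := by gcongr ?_ * ?_; exact hmono _ _ (by omega)
    have hxl : |x + lam * s ^ (2 * k)| ≤ (D + Λ) * |s| ^ (2 * k + 1) := by
      have : x + lam * s ^ (2 * k) =
          (M - E + lam * s ^ (2 * k)) / E + lam * s ^ (2 * k) * (1 - 1 / E) := by
        rw [hx]; field_simp; ring
      rw [this]
      calc _ ≤ |(M - E + lam * s ^ (2 * k)) / E| + |lam * s ^ (2 * k) * (1 - 1 / E)| :=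
            abs_add_le _ _
        _ ≤ D * |s| ^ (2 * k + 1) + Λ * |s| ^ (2 * k) * |s| := by
            refine add_le_add ?_ ?_
            · rw [abs_div, abs_of_pos hEpos]
              exact (div_le_self (abs_nonneg _) hE1').trans hρ
            · rw [abs_mul, abs_of_nonneg hEinv0]
              gcongr
              refine hEinv.trans ?_
              rw [hs2]
              nlinarith [abs_nonneg s]
        _ = _ := by ring
    have hl1 : Real.log (1 + x) ≤ x := by
      linarith [Real.log_le_sub_one_of_pos (show 0 < 1 + x by linarith)]
    have hl2 : x - 2 * x ^ 2 ≤ Real.log (1 + x) := by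
      have h1 := Real.one_sub_inv_le_log_of_pos (show 0 < 1 + x by linarith)
      refine le_trans ?_ h1
      have h2 : 1 - (1 + x)⁻¹ - (x - 2 * x ^ 2) = x ^ 2 * (1 + 2 * x) / (1 + x) := by
        have : (1 + x) ≠ 0 := by linarith
        field_simp; ring
      have h3 : 0 ≤ x ^ 2 * (1 + 2 * x) / (1 + x) :=
        div_nonneg (mul_nonneg (sq_nonneg x) (by linarith)) (by linarith)
      linarith
    rw [hlog]
    have hp : 0 ≤ |s| ^ (2 * k + 1) := by positivity
    have hp2 : 0 ≤ (Λ + 1) * |s| ^ (2 * k + 1) := by positivity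
    rw [abs_le] at hxl ⊢
    constructor <;> nlinarith [hxl.1, hxl.2]
  · have hl0 : 0 ≤ Real.log M := Real.log_nonneg hM1
    have hl1 : Real.log M ≤ s ^ 2 / 2 := by
      rwa [Real.log_le_iff_le_exp hMpos]
    have hp1 : s ^ 2 ≤ |s| ^ (2 * k + 1) := by
      rw [hs2]; exact pow_le_pow_right₀ hs.le (by omega)
    have hp2 : |s| ^ (2 * k) ≤ |s| ^ (2 * k + 1) := pow_le_pow_right₀ hs.le (by omega)
    have hp : 0 ≤ |s| ^ (2 * k + 1) := by positivity
    calc |s ^ 2 / 2 - Real.log M - lam * s ^ (2 * k)|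
        ≤ |s ^ 2 / 2 - Real.log M| + |lam * s ^ (2 * k)| := abs_sub _ _
      _ ≤ |s| ^ (2 * k + 1) + Λ * |s| ^ (2 * k + 1) := by
          refine add_le_add ?_ (hlu.trans (by gcongr))
          rw [abs_of_nonneg (by linarith)]
          nlinarith [sq_nonneg s]
      _ ≤ _ := by
          have : 0 ≤ (D + Λ + 2 * (D + Λ) ^ 2) * |s| ^ (2 * k + 1) := by positivity
          linarith

theorem iteratedDeriv_eq_of_abs_sub_le {f : ℝ → ℝ} (hf : AnalyticAt ℝ f 0) {c K : ℝ} {N : ℕ}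
    (h : ∀ s : ℝ, |f s - c * s ^ N| ≤ K * |s| ^ (N + 1)) :
    iteratedDeriv N f 0 / (N.factorial : ℝ) = c := by
  have hp : AnalyticAt ℝ (fun s : ℝ => c * s ^ N) 0 := by fun_prop
  have hg : AnalyticAt ℝ (fun s : ℝ => f s - c * s ^ N) 0 := hf.fun_sub hp
  have hord : ((N + 1 : ℕ) : ℕ∞) ≤ analyticOrderAt (fun s : ℝ => f s - c * s ^ N) 0 := by
    by_contra hlt
    rw [not_le] at hlt
    have hfin : analyticOrderAt (fun s : ℝ => f s - c * s ^ N) 0 ≠ ⊤ := ne_top_of_lt hlt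
    obtain ⟨j, hj⟩ := ENat.ne_top_iff_exists.1 hfin
    rw [← hj, Nat.cast_lt] at hlt
    obtain ⟨g, hga, hg0, hgs⟩ := (hg.analyticOrderAt_eq_natCast).1 hj.symm
    apply hg0
    have ht : Filter.Tendsto g (nhdsWithin 0 {0}ᶜ) (nhds (g 0)) :=
      hga.continuousAt.tendsto.mono_left nhdsWithin_le_nhds
    have hz : Filter.Tendsto (fun s : ℝ => K * |s| ^ (N + 1 - j)) (nhdsWithin 0 {0}ᶜ) (nhds 0) := by
      have : ContinuousAt (fun s : ℝ => K * |s| ^ (N + 1 - j)) 0 := by fun_prop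
      have h0 := this.tendsto.mono_left (nhdsWithin_le_nhds (s := {0}ᶜ))
      simpa [show N + 1 - j ≠ 0 by omega] using h0
    have hle : ∀ᶠ s in nhdsWithin (0 : ℝ) {0}ᶜ, ‖g s‖ ≤ K * |s| ^ (N + 1 - j) := by
      filter_upwards [hgs.filter_mono nhdsWithin_le_nhds, self_mem_nhdsWithin] with s hs hs0
      have h1 := h s
      rw [hs, sub_zero, smul_eq_mul, abs_mul, abs_pow] at h1
      have hpos : 0 < |s| ^ j := pow_pos (abs_pos.2 hs0) j
      rw [show N + 1 = j + (N + 1 - j) by omega, pow_add] at h1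
      refine le_of_mul_le_mul_left ?_ hpos
      rw [Real.norm_eq_abs]
      calc |s| ^ j * |g s| ≤ K * (|s| ^ j * |s| ^ (N + 1 - j)) := h1
        _ = _ := by ring
    exact tendsto_nhds_unique ht (squeeze_zero_norm' hle hz)
  rw [natCast_le_analyticOrderAt_iff_iteratedDeriv_eq_zero hg] at hord
  have h1 := hord N (Nat.lt_succ_self N)
  rw [iteratedDeriv_fun_sub hf.contDiffAt hp.contDiffAt, iteratedDeriv_const_mul_field,
    iteratedDeriv_fun_pow_zero, if_pos rfl, sub_eq_zero] at h1
  rw [h1]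
  field_simp

theorem analyticAt_Hfun (L : Measure ℝ) [IsProbabilityMeasure L]
    (hint : ∀ t : ℝ, Integrable (fun x : ℝ => Real.exp (t * x)) L) :
    AnalyticAt ℝ (Hfun L) 0 := by
  have huniv : integrableExpSet (fun x : ℝ => x) L = Set.univ := by
    ext t; simp [integrableExpSet, hint t]
  have h1 : AnalyticAt ℝ (cgf (fun x : ℝ => x) L) 0 := analyticAt_cgf (by simp [huniv])
  have h2 : AnalyticAt ℝ (fun s : ℝ => s ^ 2 / 2) 0 := by fun_prop
  exact h2.fun_sub h1

theorem lintegral_exp_linear_sub_sq {a : ℝ} (ha : 0 < a) (y : ℝ) :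
    (∫⁻ v : ℝ, ENNReal.ofReal (Real.exp (v * y - a * v ^ 2 / 2))) =
      ENNReal.ofReal (Real.sqrt (2 * Real.pi / a)) * ENNReal.ofReal (Real.exp (y ^ 2 / (2 * a))) := by
  have h1 : ∀ v : ℝ, Real.exp (v * y - a * v ^ 2 / 2) =
      Real.exp (y ^ 2 / (2 * a)) * Real.exp (-(a / 2) * (v - y / a) ^ 2) := by
    intro v
    rw [← Real.exp_add]
    congr 1
    field_simp
    ring
  have h2 : Integrable (fun v : ℝ => Real.exp (-(a / 2) * (v - y / a) ^ 2)) :=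
    (integrable_exp_neg_mul_sq (half_pos ha)).comp_sub_right (y / a)
  have h3 : (∫ v : ℝ, Real.exp (-(a / 2) * (v - y / a) ^ 2)) = Real.sqrt (2 * Real.pi / a) := by
    rw [integral_sub_right_eq_self (fun v : ℝ => Real.exp (-(a / 2) * v ^ 2)) (y / a),
      integral_gaussian]
    congr 1
    field_simp
  simp only [h1]
  rw [← ofReal_integral_eq_lintegral_ofReal (h2.const_mul _)
    (ae_of_all _ fun v => by positivity), integral_const_mul, h3,
    ENNReal.ofReal_mul (Real.exp_pos _).le, mul_comm]

theorem lintegral_lintegral_le_of_le {Ω : Type*} [MeasurableSpace Ω] (μ : Measure Ω)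
    {Y : Ω → ℝ} (hY : Measurable Y) {a : ℝ} (ha : 0 < a) {φ : ℝ → ℝ} (z : ℝ)
    (hφ : ∀ v, ∫⁻ x, ENNReal.ofReal (Real.exp (v * Y x - a * v ^ 2 / 2)) ∂μ =
      ENNReal.ofReal (φ v))
    (B : Set Ω) (S : Set ℝ) (hB : MeasurableSet B) (hS : MeasurableSet S)
    (h : ∀ x ∈ B, ∀ v ∈ S, 0 ≤ (z - v) * (Y x - a * z)) :
    ∫⁻ x in B, (∫⁻ v in S, ENNReal.ofReal (Real.exp (v * Y x - a * v ^ 2 / 2))) ∂μ ≤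
      ENNReal.ofReal (φ z) * ENNReal.ofReal (Real.sqrt (2 * Real.pi / a)) := by
  have hpt : ∀ x ∈ B, ∀ v ∈ S, ENNReal.ofReal (Real.exp (v * Y x - a * v ^ 2 / 2)) ≤
      ENNReal.ofReal (Real.exp (z * Y x - a * z ^ 2 / 2)) *
        ENNReal.ofReal (Real.exp (-(a / 2) * (v - z) ^ 2)) := by
    intro x hx v hv
    rw [← ENNReal.ofReal_mul (Real.exp_pos _).le, ← Real.exp_add]
    refine ENNReal.ofReal_le_ofReal (Real.exp_le_exp.2 ?_)
    nlinarith [h x hx v hv]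
  have hg : (∫⁻ v : ℝ, ENNReal.ofReal (Real.exp (-(a / 2) * (v - z) ^ 2))) =
      ENNReal.ofReal (Real.sqrt (2 * Real.pi / a)) := by
    have := lintegral_exp_linear_sub_sq ha 0
    rw [lintegral_sub_right_eq_self
      (fun v : ℝ => ENNReal.ofReal (Real.exp (-(a / 2) * v ^ 2))) z]
    simp only [mul_zero, zero_sub, ne_eq, OfNat.ofNat_ne_zero, not_false_eq_true, zero_pow,
      zero_div, Real.exp_zero, ENNReal.ofReal_one, mul_one] at this
    rw [← this]
    refine lintegral_congr fun v => ?_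
    congr 2
    ring
  calc ∫⁻ x in B, (∫⁻ v in S, ENNReal.ofReal (Real.exp (v * Y x - a * v ^ 2 / 2))) ∂μ
      ≤ ∫⁻ x in B, (∫⁻ v in S, ENNReal.ofReal (Real.exp (z * Y x - a * z ^ 2 / 2)) *
        ENNReal.ofReal (Real.exp (-(a / 2) * (v - z) ^ 2))) ∂μ :=
        setLIntegral_mono' hB fun x hx => setLIntegral_mono' hS fun v hv => hpt x hx v hv
    _ ≤ ∫⁻ x, (∫⁻ v, ENNReal.ofReal (Real.exp (z * Y x - a * z ^ 2 / 2)) *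
        ENNReal.ofReal (Real.exp (-(a / 2) * (v - z) ^ 2))) ∂μ :=
        (setLIntegral_le_lintegral _ _).trans
          (lintegral_mono fun x => setLIntegral_le_lintegral _ _)
    _ = _ := by
        simp_rw [lintegral_const_mul _ (show Measurable fun v : ℝ =>
          ENNReal.ofReal (Real.exp (-(a / 2) * (v - z) ^ 2)) by fun_prop)]
        rw [hg, lintegral_mul_const _ (by fun_prop), hφ]

/-- Comparison of the law with density `exp (Y² / (2a))` and its Gaussian linearization. -/
theorem abs_tilted_sub_le {Ω : Type*} [MeasurableSpace Ω] (μ : Measure Ω)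
    [IsProbabilityMeasure μ] {Y : Ω → ℝ} (hY : Measurable Y) {a : ℝ} (ha : 0 < a) {φ : ℝ → ℝ}
    (hφ0 : ∀ v, 0 ≤ φ v) (hφi : Integrable φ) (hφpos : 0 < ∫ v, φ v)
    (hφ : ∀ v, ∫⁻ x, ENNReal.ofReal (Real.exp (v * Y x - a * v ^ 2 / 2)) ∂μ =
      ENNReal.ofReal (φ v)) (ν : Measure Ω)
    (hν : ν = μ.withDensity fun x => ENNReal.ofReal (Real.exp (Y x ^ 2 / (2 * a)))) (z : ℝ) :
    |((ν Set.univ)⁻¹ * ν {x | Y x ≤ a * z}).toReal - (∫ v in Set.Iic z, φ v) / ∫ v, φ v| ≤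
      φ z * Real.sqrt (2 * Real.pi / a) / ∫ v, φ v := by
  set κ := Real.sqrt (2 * Real.pi / a) with hκ
  have hκpos : 0 < κ := Real.sqrt_pos.2 (by positivity)
  set G : Ω → ℝ → ENNReal := fun x v => ENNReal.ofReal (Real.exp (v * Y x - a * v ^ 2 / 2))
    with hG
  have hGm : Measurable (Function.uncurry G) := by
    have h1 : Measurable fun p : Ω × ℝ => Y p.1 := hY.comp measurable_fst
    have h2 : Measurable fun p : Ω × ℝ => p.2 := measurable_snd
    exact ((h2.mul h1).sub (((h2.pow_const 2).const_mul a).div_const 2)).exp.ennreal_ofReal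
  have hνB : ∀ B : Set Ω, MeasurableSet B →
      ENNReal.ofReal κ * ν B = ∫⁻ x in B, (∫⁻ v, G x v) ∂μ := by
    intro B hB
    rw [hν, withDensity_apply _ hB, ← lintegral_const_mul _ (by fun_prop)]
    exact lintegral_congr fun x => (lintegral_exp_linear_sub_sq ha (Y x)).symm
  have hswap : ∀ S : Set ℝ, MeasurableSet S →
      ∫⁻ x, (∫⁻ v in S, G x v) ∂μ = ENNReal.ofReal (∫ v in S, φ v) := by
    intro S hS
    rw [lintegral_lintegral_swap hGm.aemeasurable,
      ofReal_integral_eq_lintegral_ofReal hφi.integrableOn (ae_of_all _ hφ0)]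
    exact lintegral_congr fun v => hφ v
  set B := {x | Y x ≤ a * z} with hBdef
  have hB : MeasurableSet B := measurableSet_le hY measurable_const
  have hsplit : ∀ x, ∫⁻ v, G x v =
      (∫⁻ v in Set.Iic z, G x v) + ∫⁻ v in (Set.Iic z)ᶜ, G x v := fun x =>
    (lintegral_add_compl _ measurableSet_Iic).symm
  have hmeasS : ∀ S : Set ℝ, Measurable fun x => ∫⁻ v in S, G x v := fun S =>
    hGm.lintegral_prod_right'
  have hφκ : ENNReal.ofReal (φ z) * ENNReal.ofReal κ = ENNReal.ofReal (φ z * κ) :=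
    (ENNReal.ofReal_mul (hφ0 z)).symm
  have hup : ENNReal.ofReal κ * ν B ≤
      ENNReal.ofReal (∫ v in Set.Iic z, φ v) + ENNReal.ofReal (φ z * κ) := by
    rw [hνB B hB]
    simp_rw [hsplit]
    rw [lintegral_add_left (hmeasS _), ← hswap _ measurableSet_Iic, ← hφκ]
    refine add_le_add (setLIntegral_le_lintegral _ _)
      (lintegral_lintegral_le_of_le μ hY ha z hφ B _ hB measurableSet_Iic.compl ?_)
    intro x hx v hv
    have h1 : Y x ≤ a * z := hx
    have h2 : z < v := by simpa using hv
    nlinarith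
  have hlow : ENNReal.ofReal (∫ v in Set.Iic z, φ v) ≤
      ENNReal.ofReal κ * ν B + ENNReal.ofReal (φ z * κ) := by
    rw [hνB B hB, ← hswap _ measurableSet_Iic, ← hφκ, ← lintegral_add_compl _ hB]
    refine add_le_add (lintegral_mono fun x => setLIntegral_le_lintegral _ _)
      (lintegral_lintegral_le_of_le μ hY ha z hφ Bᶜ _ hB.compl measurableSet_Iic ?_)
    intro x hx v hv
    have h1 : a * z < Y x := by simpa [hBdef] using hx
    have h2 : v ≤ z := hv
    nlinarith
  have htot : ENNReal.ofReal κ * ν Set.univ = ENNReal.ofReal (∫ v, φ v) := by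
    rw [hνB _ MeasurableSet.univ, ← setIntegral_univ (f := φ), ← hswap _ MeasurableSet.univ]
    simp
  have hκ0 : ENNReal.ofReal κ ≠ 0 := by simpa using hκpos
  have htop : ν Set.univ ≠ ⊤ := by
    intro h
    rw [h, ENNReal.mul_top hκ0] at htot
    exact ENNReal.ofReal_ne_top htot.symm
  have hBtop : ν B ≠ ⊤ := ne_top_of_le_ne_top htop (measure_mono (Set.subset_univ _))
  have hI0 : 0 ≤ ∫ v in Set.Iic z, φ v := integral_nonneg hφ0
  have htot' : κ * (ν Set.univ).toReal = ∫ v, φ v := by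
    have := congrArg ENNReal.toReal htot
    rwa [ENNReal.toReal_mul, ENNReal.toReal_ofReal hκpos.le,
      ENNReal.toReal_ofReal hφpos.le] at this
  have hfin : ENNReal.ofReal κ * ν B ≠ ⊤ := ENNReal.mul_ne_top ENNReal.ofReal_ne_top hBtop
  have hconv : κ * (ν B).toReal = (ENNReal.ofReal κ * ν B).toReal := by
    rw [ENNReal.toReal_mul, ENNReal.toReal_ofReal hκpos.le]
  have hφκ0 : 0 ≤ φ z * κ := mul_nonneg (hφ0 z) hκpos.le
  have hup' : κ * (ν B).toReal ≤ (∫ v in Set.Iic z, φ v) + φ z * κ := by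
    rw [hconv]
    refine ENNReal.toReal_le_of_le_ofReal (by positivity) ?_
    rwa [ENNReal.ofReal_add hI0 hφκ0]
  have hlow' : (∫ v in Set.Iic z, φ v) ≤ κ * (ν B).toReal + φ z * κ := by
    have h1 : ENNReal.ofReal κ * ν B = ENNReal.ofReal (κ * (ν B).toReal) := by
      rw [hconv, ENNReal.ofReal_toReal hfin]
    rw [h1, ← ENNReal.ofReal_add (by positivity) hφκ0] at hlow
    exact (ENNReal.ofReal_le_ofReal_iff (by positivity)).1 hlow
  have hratio : ((ν Set.univ)⁻¹ * ν B).toReal = κ * (ν B).toReal / ∫ v, φ v := by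
    rw [ENNReal.toReal_mul, ENNReal.toReal_inv, ← htot']
    field_simp
  rw [hratio, ← sub_div, abs_div, abs_of_pos hφpos]
  gcongr
  rw [abs_le]
  constructor <;> linarith

theorem setIntegral_abs_mul_le {u U : ℝ → ℝ} {p : ℕ} (hu : Integrable u) (hU : Integrable U)
    (h : ∀ v, |u v| * (1 + |v| ^ p) ≤ U v) {S : Set ℝ} (hS : MeasurableSet S) {z : ℝ}
    (hz : ∀ v ∈ S, |z| ≤ |v|) :
    |∫ v in S, u v| * (1 + |z| ^ p) ≤ ∫ v, U v := by
  have hU0 : ∀ v, 0 ≤ U v := fun v => le_trans (by positivity) (h v)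
  calc |∫ v in S, u v| * (1 + |z| ^ p) ≤ (∫ v in S, |u v|) * (1 + |z| ^ p) := by
        gcongr
        exact abs_integral_le_integral_abs
    _ = ∫ v in S, |u v| * (1 + |z| ^ p) := (integral_mul_const _ _).symm
    _ ≤ ∫ v in S, U v := by
        refine setIntegral_mono_on (hu.abs.mul_const _).integrableOn hU.integrableOn hS
          fun v hv => le_trans ?_ (h v)
        have := hz v hv
        gcongr
    _ ≤ ∫ v, U v := setIntegral_le_integral hU (ae_of_all _ hU0)

theorem abs_setIntegral_ratio_sub_le {f fn U G : ℝ → ℝ} {p : ℕ} {q : ℝ} (hf : Integrable f)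
    (hfn : Integrable fn) (hU : Integrable U) (hG : Integrable G)
    (hdiff : ∀ v, |fn v - f v| * (1 + |v| ^ p) ≤ U v)
    (hfG : ∀ v, |f v| * (1 + |v| ^ p) ≤ G v) (hq : 0 < q) (hZ : q ≤ ∫ v, f v)
    (hZn : q ≤ ∫ v, fn v) {S : Set ℝ} (hS : MeasurableSet S) {z : ℝ}
    (hz : ∀ v ∈ S, |z| ≤ |v|) :
    |(∫ v in S, fn v) / (∫ v, fn v) - (∫ v in S, f v) / ∫ v, f v| * (1 + |z| ^ p) ≤
      (∫ v, U v) / q + (∫ v, G v) * (∫ v, U v) / q ^ 2 := by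
  have h1 := setIntegral_abs_mul_le (hfn.sub hf) hU hdiff hS hz
  have h2 := setIntegral_abs_mul_le hf hG hfG hS hz
  have h3 := setIntegral_abs_mul_le (hfn.sub hf) hU hdiff MeasurableSet.univ (z := 0)
    fun v _ => by simp
  simp only [Pi.sub_apply] at h1 h3
  rw [integral_sub hfn.integrableOn hf.integrableOn] at h1 h3
  rw [setIntegral_univ, setIntegral_univ] at h3
  set A := ∫ v in S, f v
  set An := ∫ v in S, fn v
  set Z := ∫ v, f v
  set Zn := ∫ v, fn v
  set J := ∫ v, U v
  set I := ∫ v, G v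
  set w := 1 + |z| ^ p
  have hw : 0 < w := by positivity
  have h3' : |Zn - Z| ≤ J := by
    refine le_trans (le_mul_of_one_le_right (abs_nonneg _) ?_) h3
    have : (0 : ℝ) ≤ |0| ^ p := by positivity
    linarith
  have hZpos : 0 < Z := hq.trans_le hZ
  have hZnpos : 0 < Zn := hq.trans_le hZn
  have hJ : 0 ≤ J := (abs_nonneg _).trans h3'
  have hI : 0 ≤ I := le_trans (by positivity) h2
  have hdec : An / Zn - A / Z = (An - A) / Zn + A * (Z - Zn) / (Z * Zn) := by
    field_simp
    ring
  calc |An / Zn - A / Z| * w ≤ (|(An - A) / Zn| + |A * (Z - Zn) / (Z * Zn)|) * w := by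
        rw [hdec]
        gcongr
        exact abs_add_le _ _
    _ = |An - A| * w / Zn + (|A| * w) * |Zn - Z| / (Z * Zn) := by
        rw [abs_div, abs_div, abs_mul, abs_of_pos hZnpos, abs_of_pos (mul_pos hZpos hZnpos),
          abs_sub_comm Z Zn]
        ring
    _ ≤ J / q + I * J / q ^ 2 := by
        rw [sq]
        gcongr

theorem abs_cdf_ratio_sub_le {f fn U G : ℝ → ℝ} {p : ℕ} {q : ℝ} (hf : Integrable f)
    (hfn : Integrable fn) (hU : Integrable U) (hG : Integrable G)
    (hdiff : ∀ v, |fn v - f v| * (1 + |v| ^ p) ≤ U v)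
    (hfG : ∀ v, |f v| * (1 + |v| ^ p) ≤ G v) (hq : 0 < q) (hZ : q ≤ ∫ v, f v)
    (hZn : q ≤ ∫ v, fn v) (z : ℝ) :
    |(∫ v in Set.Iic z, fn v) / (∫ v, fn v) - (∫ v in Set.Iic z, f v) / ∫ v, f v| *
      (1 + |z| ^ p) ≤ (∫ v, U v) / q + (∫ v, G v) * (∫ v, U v) / q ^ 2 := by
  have key := fun {S : Set ℝ} (hS : MeasurableSet S) =>
    abs_setIntegral_ratio_sub_le hf hfn hU hG hdiff hfG hq hZ hZn hS (z := z)
  rcases lt_or_ge z 0 with hz | hz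
  · refine key measurableSet_Iic fun v hv => ?_
    have hv' : v ≤ z := hv
    rw [abs_of_neg hz, abs_of_neg (hv'.trans_lt hz)]
    linarith
  · have h := key (S := (Set.Iic z)ᶜ) measurableSet_Iic.compl fun v hv => by
      have hv' : z < v := by simpa using hv
      rw [abs_of_nonneg hz, abs_of_nonneg (hz.trans hv'.le)]
      exact hv'.le
    have e : ∀ g : ℝ → ℝ, Integrable g → 0 < ∫ v, g v →
        (∫ v in (Set.Iic z)ᶜ, g v) / (∫ v, g v) = 1 - (∫ v in Set.Iic z, g v) / ∫ v, g v := by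
      intro g hg hg0
      rw [← integral_add_compl (measurableSet_Iic (a := z)) hg] at hg0 ⊢
      field_simp
      ring
    rw [e fn hfn (hq.trans_le hZn), e f hf (hq.trans_le hZ), sub_sub_sub_cancel_left,
      abs_sub_comm] at h
    exact h

theorem le_integral_of_le_on_Icc {f : ℝ → ℝ} (hf : Integrable f) (hf0 : ∀ v, 0 ≤ f v) {B : ℝ}
    (h : ∀ v, |v| ≤ 1 → Real.exp (-B) ≤ f v) : 2 * Real.exp (-B) ≤ ∫ v, f v := by
  calc 2 * Real.exp (-B) = ∫ _ in Set.Icc (-1 : ℝ) 1, Real.exp (-B) := by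
        simp [Measure.real]
        norm_num
    _ ≤ ∫ v in Set.Icc (-1 : ℝ) 1, f v :=
        setIntegral_mono_on (by simp) hf.integrableOn measurableSet_Icc
          fun v hv => h v (abs_le.2 hv)
    _ ≤ _ := setIntegral_le_integral hf (ae_of_all _ hf0)

theorem integrable_abs_pow_mul_exp_neg_mul_sq {d : ℝ} (hd : 0 < d) (j : ℕ) :
    Integrable fun v : ℝ => |v| ^ j * Real.exp (-d * v ^ 2) := by
  have h := (integrable_rpow_mul_exp_neg_mul_sq hd (s := j)
    (by linarith [(Nat.cast_nonneg j : (0 : ℝ) ≤ j)])).abs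
  refine h.congr (ae_of_all _ fun v => ?_)
  simp only [Real.rpow_natCast]
  rw [abs_mul, abs_pow, abs_of_pos (Real.exp_pos _)]

theorem exp_neg_mul_sq_mul_le {d : ℝ} (hd : 0 < d) (p : ℕ) (v : ℝ) :
    Real.exp (-d * v ^ 2) * (1 + |v| ^ p) ≤ 2 + (p.factorial : ℝ) / d ^ p := by
  have h1 : |v| ^ p ≤ 1 + (v ^ 2) ^ p := by
    rcases le_or_gt |v| 1 with h | h
    · have := pow_le_one₀ (n := p) (abs_nonneg v) h
      have : 0 ≤ (v ^ 2) ^ p := by positivity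
      linarith
    · rw [← sq_abs, ← pow_mul]
      have := pow_le_pow_right₀ h.le (show p ≤ 2 * p by omega)
      linarith
  have h2 : (v ^ 2) ^ p ≤ (p.factorial : ℝ) / d ^ p * Real.exp (d * v ^ 2) := by
    have := Real.pow_div_factorial_le_exp (d * v ^ 2) (by positivity) p
    rw [div_le_iff₀ (by positivity), mul_pow] at this
    rw [div_mul_eq_mul_div, le_div_iff₀ (by positivity)]
    linarith
  have h3 : Real.exp (-d * v ^ 2) * Real.exp (d * v ^ 2) = 1 := by
    rw [← Real.exp_add, neg_mul, neg_add_cancel, Real.exp_zero]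
  have h4 : Real.exp (-d * v ^ 2) ≤ 1 := Real.exp_le_one_iff.2 (by nlinarith [sq_nonneg v])
  calc Real.exp (-d * v ^ 2) * (1 + |v| ^ p)
      ≤ Real.exp (-d * v ^ 2) *
        (1 + (1 + (p.factorial : ℝ) / d ^ p * Real.exp (d * v ^ 2))) := by
        gcongr
        linarith
    _ = 2 * Real.exp (-d * v ^ 2) +
        (p.factorial : ℝ) / d ^ p * (Real.exp (-d * v ^ 2) * Real.exp (d * v ^ 2)) := by ring
    _ ≤ _ := by rw [h3]; linarith

theorem abs_exp_neg_sub_exp_neg_le {a b g : ℝ} (ha : Real.exp (-a) ≤ g) (hb : Real.exp (-b) ≤ g) :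
    |Real.exp (-a) - Real.exp (-b)| ≤ |a - b| * g := by
  have key : ∀ x y : ℝ, Real.exp (-x) ≤ g → Real.exp (-x) - Real.exp (-y) ≤ |x - y| * g := by
    intro x y hx
    have h1 : Real.exp (-y) = Real.exp (-x) * Real.exp (x - y) := by
      rw [← Real.exp_add]; congr 1; ring
    have h2 := Real.add_one_le_exp (x - y)
    have h3 : -(x - y) ≤ |x - y| := neg_le_abs _
    have h4 := Real.exp_pos (-x)
    calc Real.exp (-x) - Real.exp (-y) = Real.exp (-x) * (1 - Real.exp (x - y)) := by
          rw [h1]; ring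
      _ ≤ Real.exp (-x) * |x - y| := by gcongr; linarith
      _ ≤ g * |x - y| := by gcongr
      _ = _ := mul_comm _ _
  rw [abs_le]
  have h1 := key a b ha
  have h2 := key b a hb
  rw [abs_sub_comm] at h2
  constructor <;> linarith

theorem le_Hfun {L : Measure ℝ} {s B : ℝ} (h1 : 1 ≤ ∫ x : ℝ, Real.exp (s * x) ∂L)
    (h : (∫ x : ℝ, Real.exp (s * x) ∂L) ≤ Real.exp (s ^ 2 / 2 - B)) : B ≤ Hfun L s := by
  have := (Real.log_le_iff_le_exp (by linarith)).2 h
  unfold Hfun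
  linarith

/-- The normalized `2k`-th moment of the standard normal distribution. -/
noncomputable def momentRatio (k : ℕ) : ℝ := stdNormMoment (2 * k) / ((2 * k).factorial : ℝ)

/-- A constant bounding the remainder in the expansion of `Hfun` of order `2k`. -/
noncomputable def remainderConst (k : ℕ) : ℝ :=
  4 * ((2 * k + 1).factorial : ℝ) * Real.exp 2 + 2 * momentRatio k + 1 +
    2 * (4 * ((2 * k + 1).factorial : ℝ) * Real.exp 2 + momentRatio k) ^ 2

theorem momentRatio_nonneg (k : ℕ) : 0 ≤ momentRatio k := by
  unfold momentRatio
  rw [stdNormMoment_eq]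
  have : 0 ≤ ∫ x : ℝ, x ^ (2 * k) ∂(gaussianReal 0 1) :=
    integral_nonneg fun x => (even_two_mul k).pow_nonneg x
  positivity

theorem remainderConst_pos (k : ℕ) : 0 < remainderConst k := by
  have := momentRatio_nonneg k
  unfold remainderConst
  positivity

theorem stdNormMoment_two : stdNormMoment 2 = 1 := by
  rw [stdNormMoment_eq]
  have h := variance_id_gaussianReal (μ := 0) (v := 1)
  rw [variance_of_integral_eq_zero (by fun_prop) (by simp)] at h
  simpa using h

theorem mgf_le_exp_half_sq {L : Measure ℝ} {k : ℕ} {b₀ b₁ b₂ : ℝ} (hb₁ : 0 < b₁) (hb₂ : 1 < b₂)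
    (h₁ : ∀ t : ℝ, |t| ≤ b₀ →
      (∫ x : ℝ, Real.exp (t * x) ∂L) ≤ Real.exp (t ^ 2 / 2 - b₁ * t ^ (2 * k)))
    (h₂ : ∀ t : ℝ, b₀ < |t| →
      (∫ x : ℝ, Real.exp (t * x) ∂L) ≤ Real.exp (t ^ 2 / (2 * b₂))) (t : ℝ) :
    (∫ x : ℝ, Real.exp (t * x) ∂L) ≤ Real.exp (t ^ 2 / 2) := by
  rcases le_or_gt |t| b₀ with h | h
  · refine (h₁ t h).trans (Real.exp_le_exp.2 ?_)
    have : 0 ≤ b₁ * t ^ (2 * k) := mul_nonneg hb₁.le ((even_two_mul k).pow_nonneg t)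
    linarith
  · refine (h₂ t h).trans (Real.exp_le_exp.2 ?_)
    gcongr
    linarith

theorem Hfun_expansion (L : Measure ℝ) [IsProbabilityMeasure L] {k : ℕ} (hk : 1 ≤ k)
    {b₀ b₁ b₂ : ℝ} (hb₀ : 0 < b₀) (hb₁ : 0 < b₁) (hb₂ : 1 < b₂)
    (hi : Integrable (fun x : ℝ => x) L) (h0 : (∫ x : ℝ, x ∂L) = 0)
    (hvar : (∫ x : ℝ, x ^ 2 ∂L) = 1)
    (hmom : ∀ j : ℕ, 1 ≤ j → j ≤ 2 * k - 1 → stdNormMoment j - (∫ x : ℝ, x ^ j ∂L) = 0)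
    (hint : ∀ t : ℝ, Integrable (fun x : ℝ => Real.exp (t * x)) L)
    (h₁ : ∀ t : ℝ, |t| ≤ b₀ →
      (∫ x : ℝ, Real.exp (t * x) ∂L) ≤ Real.exp (t ^ 2 / 2 - b₁ * t ^ (2 * k)))
    (h₂ : ∀ t : ℝ, b₀ < |t| →
      (∫ x : ℝ, Real.exp (t * x) ∂L) ≤ Real.exp (t ^ 2 / (2 * b₂)))
    {c₂ : ℝ} (hc₂ : c₂ = iteratedDeriv (2 * k) (Hfun L) 0 / (Nat.factorial (2 * k) : ℝ)) :
    2 ≤ k ∧ b₁ ≤ c₂ ∧ c₂ ≤ momentRatio k ∧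
      ∀ s, |Hfun L s - c₂ * s ^ (2 * k)| ≤ remainderConst k * |s| ^ (2 * k + 1) := by
  have hle := mgf_le_exp_half_sq hb₁ hb₂ h₁ h₂
  have hone := one_le_mgf L hi h0 hint
  set lam := (stdNormMoment (2 * k) - ∫ x : ℝ, x ^ (2 * k) ∂L) / ((2 * k).factorial : ℝ)
    with hlam
  have hexp : ∀ Λ : ℝ, |lam| ≤ Λ → ∀ s : ℝ, |Hfun L s - lam * s ^ (2 * k)| ≤
      (4 * ((2 * k + 1).factorial : ℝ) * Real.exp 2 + 2 * Λ + 1 +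
        2 * (4 * ((2 * k + 1).factorial : ℝ) * Real.exp 2 + Λ) ^ 2) * |s| ^ (2 * k + 1) :=
    fun Λ hΛ s => abs_half_sq_sub_log_sub_le hk (by positivity) hΛ (hone s) (hle s)
      fun hs => abs_mgf_sub_exp_le L k hint hle hmom hs
  have hc : c₂ = lam := by
    rw [hc₂]
    exact iteratedDeriv_eq_of_abs_sub_le (analyticAt_Hfun L hint) (hexp |lam| le_rfl)
  have hlow : b₁ ≤ lam := by
    by_contra! hlt
    have h := hexp |lam| le_rfl
    set K := 4 * ((2 * k + 1).factorial : ℝ) * Real.exp 2 + 2 * |lam| + 1 +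
        2 * (4 * ((2 * k + 1).factorial : ℝ) * Real.exp 2 + |lam|) ^ 2
    have hK : 0 < K := by positivity
    set s := min b₀ ((b₁ - lam) / (2 * K))
    have hs : 0 < s := lt_min hb₀ (div_pos (by linarith) (by positivity))
    have hs1 : s * (2 * K) ≤ b₁ - lam := by
      rw [← le_div_iff₀ (by positivity)]
      exact min_le_right _ _
    have hsb : |s| ≤ b₀ := by rw [abs_of_pos hs]; exact min_le_left _ _
    have hH := le_Hfun (hone s) (h₁ s hsb)
    have h' := (abs_le.1 (h s)).2
    rw [abs_of_pos hs, pow_succ] at h'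
    have hp : 0 < s ^ (2 * k) := by positivity
    have : (b₁ - lam) * s ^ (2 * k) ≤ (K * s) * s ^ (2 * k) := by linarith
    have := le_of_mul_le_mul_right this hp
    linarith
  have hup : lam ≤ momentRatio k := by
    rw [hlam, momentRatio]
    gcongr
    have : 0 ≤ ∫ x : ℝ, x ^ (2 * k) ∂L := integral_nonneg fun x => (even_two_mul k).pow_nonneg x
    linarith
  refine ⟨?_, hc ▸ hlow, hc ▸ hup, ?_⟩
  · by_contra hk2
    have hk1 : k = 1 := by omega
    have : lam = 0 := by
      rw [hlam, hk1, mul_one, hvar, stdNormMoment_two, sub_self, zero_div]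
    linarith
  · rw [hc]
    exact hexp _ (by rwa [abs_of_nonneg (by linarith)])

theorem lintegral_pi_exp_eq (L : Measure ℝ) [IsProbabilityMeasure L]
    (hint : ∀ t : ℝ, Integrable (fun x : ℝ => Real.exp (t * x)) L)
    (hone : ∀ t : ℝ, 1 ≤ ∫ x : ℝ, Real.exp (t * x) ∂L) (n : ℕ) {m : ℝ} (hm : 0 < m) (v : ℝ) :
    ∫⁻ x : Fin n → ℝ, ENNReal.ofReal
        (Real.exp (v * ((∑ i, x i) / m) - (n : ℝ) / m ^ 2 * v ^ 2 / 2))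
        ∂(Measure.pi fun _ : Fin n => L) =
      ENNReal.ofReal (Real.exp (-((n : ℝ) * Hfun L (v / m)))) := by
  have h1 : ∀ x : Fin n → ℝ,
      Real.exp (v * ((∑ i, x i) / m) - (n : ℝ) / m ^ 2 * v ^ 2 / 2) =
      Real.exp (-((n : ℝ) / m ^ 2 * v ^ 2 / 2)) * ∏ i, Real.exp (v / m * x i) := by
    intro x
    rw [← Real.exp_sum, ← Real.exp_add, ← Finset.mul_sum]
    congr 1
    ring
  have hpi : Integrable (fun x : Fin n → ℝ => ∏ i, Real.exp (v / m * x i))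
      (Measure.pi fun _ : Fin n => L) :=
    Integrable.fintype_prod fun _ => hint (v / m)
  have hpos : 0 < ∫ x : ℝ, Real.exp (v / m * x) ∂L := by linarith [hone (v / m)]
  simp only [h1]
  rw [← ofReal_integral_eq_lintegral_ofReal (hpi.const_mul _)
    (ae_of_all _ fun x => by positivity), integral_const_mul,
    integral_fintype_prod_eq_pow (fun x : ℝ => Real.exp (v / m * x)), Fintype.card_fin]
  congr 1
  unfold Hfun
  rw [mul_sub, neg_sub, sub_eq_neg_add, Real.exp_add, Real.exp_nat_mul, Real.exp_log hpos]
  congr 2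
  field_simp

theorem continuous_Hfun (L : Measure ℝ) [IsProbabilityMeasure L]
    (hint : ∀ t : ℝ, Integrable (fun x : ℝ => Real.exp (t * x)) L)
    (hone : ∀ t : ℝ, 1 ≤ ∫ x : ℝ, Real.exp (t * x) ∂L) : Continuous (Hfun L) := by
  have h1 : Continuous (mgf (fun x : ℝ => x) L) := continuous_mgf hint
  have h2 : Continuous fun s : ℝ => Real.log (∫ x : ℝ, Real.exp (s * x) ∂L) :=
    h1.log fun s => by have := hone s; simp only [mgf]; linarith
  exact ((continuous_pow 2).div_const 2).sub h2

theorem exp_neg_mul_pow_le {k : ℕ} (hk : 1 ≤ k) {b d : ℝ} (hb : 0 ≤ b) (hdb : d ≤ b) (v : ℝ) :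
    Real.exp (-(b * v ^ (2 * k))) ≤ Real.exp b * Real.exp (-d * v ^ 2) := by
  rw [← Real.exp_add]
  refine Real.exp_le_exp.2 ?_
  have h : v ^ 2 ≤ 1 + v ^ (2 * k) := by
    rw [pow_mul]
    rcases le_or_gt (v ^ 2) 1 with h | h
    · have : 0 ≤ (v ^ 2) ^ k := by positivity
      linarith
    · linarith [le_self_pow₀ h.le (by omega : k ≠ 0)]
  have h1 : b * v ^ 2 ≤ b * (1 + v ^ (2 * k)) := by gcongr
  have h2 : d * v ^ 2 ≤ b * v ^ 2 := by gcongr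
  linarith

theorem exp_neg_mul_Hfun_le (L : Measure ℝ) {k : ℕ} (hk : 2 ≤ k) {b₀ b₁ b₂ d : ℝ} (hb₁ : 0 < b₁)
    (hd : d ≤ b₁) (hd0 : 0 < d) (hd2 : d ≤ (1 - 1 / b₂) / 2)
    (hone : ∀ t : ℝ, 1 ≤ ∫ x : ℝ, Real.exp (t * x) ∂L)
    (h₁ : ∀ t : ℝ, |t| ≤ b₀ →
      (∫ x : ℝ, Real.exp (t * x) ∂L) ≤ Real.exp (t ^ 2 / 2 - b₁ * t ^ (2 * k)))
    (h₂ : ∀ t : ℝ, b₀ < |t| →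
      (∫ x : ℝ, Real.exp (t * x) ∂L) ≤ Real.exp (t ^ 2 / (2 * b₂)))
    {m : ℝ} (hm : 1 ≤ m) (v : ℝ) :
    Real.exp (-(m ^ (2 * k) * Hfun L (v / m))) ≤ Real.exp b₁ * Real.exp (-d * v ^ 2) := by
  have hm0 : 0 < m := by linarith
  rcases le_or_gt |v / m| b₀ with h | h
  · refine le_trans (Real.exp_le_exp.2 ?_) (exp_neg_mul_pow_le (k := k) (by omega) hb₁.le hd v)
    have h3 := le_Hfun (hone _) (h₁ _ h)
    have h4 : m ^ (2 * k) * (b₁ * (v / m) ^ (2 * k)) = b₁ * v ^ (2 * k) := by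
      rw [div_pow]
      field_simp
    rw [neg_le_neg_iff, ← h4]
    gcongr
  · rw [← Real.exp_add]
    refine Real.exp_le_exp.2 ?_
    have h3 : d * (v / m) ^ 2 ≤ Hfun L (v / m) := by
      refine le_Hfun (hone _) ((h₂ _ h).trans (Real.exp_le_exp.2 ?_))
      have : (v / m) ^ 2 / (2 * b₂) = (v / m) ^ 2 / 2 - (1 - 1 / b₂) / 2 * (v / m) ^ 2 := by ring
      rw [this]
      gcongr
    have h4 : d * v ^ 2 ≤ m ^ (2 * k) * (d * (v / m) ^ 2) := by
      have h5 : m ^ 2 ≤ m ^ (2 * k) := pow_le_pow_right₀ hm (by omega)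
      calc d * v ^ 2 = m ^ 2 * (d * (v / m) ^ 2) := by field_simp
        _ ≤ _ := by gcongr
    have h5 : m ^ (2 * k) * (d * (v / m) ^ 2) ≤ m ^ (2 * k) * Hfun L (v / m) := by gcongr
    linarith

theorem abs_scaled_Hfun_sub_le (L : Measure ℝ) {k : ℕ} {c K : ℝ}
    (h : ∀ s, |Hfun L s - c * s ^ (2 * k)| ≤ K * |s| ^ (2 * k + 1)) {m : ℝ} (hm : 0 < m) (v : ℝ) :
    |m ^ (2 * k) * Hfun L (v / m) - c * v ^ (2 * k)| ≤ K * |v| ^ (2 * k + 1) / m := by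
  have h1 : m ^ (2 * k) * Hfun L (v / m) - c * v ^ (2 * k) =
      m ^ (2 * k) * (Hfun L (v / m) - c * (v / m) ^ (2 * k)) := by
    rw [div_pow]
    field_simp
  rw [h1, abs_mul, abs_of_pos (by positivity)]
  calc m ^ (2 * k) * |Hfun L (v / m) - c * (v / m) ^ (2 * k)|
      ≤ m ^ (2 * k) * (K * |v / m| ^ (2 * k + 1)) := by gcongr; exact h _
    _ = _ := by
      rw [abs_div, abs_of_pos hm, div_pow, pow_succ m]
      field_simp

theorem integrable_gaussian_weights {d : ℝ} (hd : 0 < d) (A : ℝ) (j p : ℕ) :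
    Integrable fun v : ℝ => |v| ^ j * (A * Real.exp (-d * v ^ 2)) * (1 + |v| ^ p) := by
  have h := ((integrable_abs_pow_mul_exp_neg_mul_sq hd j).add
    (integrable_abs_pow_mul_exp_neg_mul_sq hd (j + p))).const_mul A
  refine h.congr (ae_of_all _ fun v => ?_)
  simp only [Pi.add_apply, pow_add]
  ring

/-- The target density approximates the linearized one, with explicit constants. -/
theorem abs_linearized_cdf_sub_le (L : Measure ℝ) {k p : ℕ} (hk : 1 ≤ k) {b₁ c₂ d Λ K : ℝ}
    (hd0 : 0 < d) (hd : d ≤ b₁) (hb₁ : b₁ ≤ c₂) (hc₂ : c₂ ≤ Λ) (hK : 0 ≤ K)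
    (h : ∀ s, |Hfun L s - c₂ * s ^ (2 * k)| ≤ K * |s| ^ (2 * k + 1)) (hcont : Continuous (Hfun L))
    {m : ℝ} (hm : 1 ≤ m)
    (hle : ∀ v, Real.exp (-(m ^ (2 * k) * Hfun L (v / m))) ≤
      Real.exp b₁ * Real.exp (-d * v ^ 2)) :
    Integrable (fun v => Real.exp (-(m ^ (2 * k) * Hfun L (v / m)))) ∧
    Integrable (fun v => Real.exp (-c₂ * v ^ (2 * k))) ∧
    2 * Real.exp (-(Λ + K)) ≤ ∫ v, Real.exp (-(m ^ (2 * k) * Hfun L (v / m))) ∧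
    ∀ z : ℝ,
      |(∫ v in Set.Iic z, Real.exp (-(m ^ (2 * k) * Hfun L (v / m)))) /
          (∫ v, Real.exp (-(m ^ (2 * k) * Hfun L (v / m)))) -
        (∫ v in Set.Iic z, Real.exp (-c₂ * v ^ (2 * k))) /
          ∫ v, Real.exp (-c₂ * v ^ (2 * k))| * (1 + |z| ^ p) ≤
      ((K * ∫ v : ℝ, |v| ^ (2 * k + 1) * (Real.exp b₁ * Real.exp (-d * v ^ 2)) * (1 + |v| ^ p)) /
          (2 * Real.exp (-(Λ + K))) +
        (∫ v : ℝ, |v| ^ 0 * (Real.exp b₁ * Real.exp (-d * v ^ 2)) * (1 + |v| ^ p)) *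
          (K * ∫ v : ℝ, |v| ^ (2 * k + 1) * (Real.exp b₁ * Real.exp (-d * v ^ 2)) *
            (1 + |v| ^ p)) / (2 * Real.exp (-(Λ + K))) ^ 2) / m := by
  have hm0 : 0 < m := by linarith
  have hb₁0 : 0 < b₁ := hd0.trans_le hd
  have hc0 : 0 < c₂ := hb₁0.trans_le hb₁
  have hev : ∀ v : ℝ, 0 ≤ v ^ (2 * k) := fun v => (even_two_mul k).pow_nonneg v
  set g : ℝ → ℝ := fun v => Real.exp b₁ * Real.exp (-d * v ^ 2) with hg
  have hgi : Integrable g := (integrable_exp_neg_mul_sq hd0).const_mul _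
  set f : ℝ → ℝ := fun v => Real.exp (-c₂ * v ^ (2 * k)) with hf
  set fn : ℝ → ℝ := fun v => Real.exp (-(m ^ (2 * k) * Hfun L (v / m))) with hfn
  have hfg : ∀ v, f v ≤ g v := fun v => by
    refine le_trans (Real.exp_le_exp.2 ?_) (exp_neg_mul_pow_le hk hb₁0.le hd v)
    have : b₁ * v ^ (2 * k) ≤ c₂ * v ^ (2 * k) := mul_le_mul_of_nonneg_right hb₁ (hev v)
    linarith
  have hfi : Integrable f := by
    refine hgi.mono' (Continuous.aestronglyMeasurable (by fun_prop)) (ae_of_all _ fun v => ?_)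
    rw [Real.norm_eq_abs, abs_of_pos (Real.exp_pos _)]
    exact hfg v
  have hfni : Integrable fn := by
    refine hgi.mono' (Continuous.aestronglyMeasurable (by fun_prop)) (ae_of_all _ fun v => ?_)
    rw [Real.norm_eq_abs, abs_of_pos (Real.exp_pos _)]
    exact hle v
  have hZ : 2 * Real.exp (-(Λ + K)) ≤ ∫ v, f v := by
    refine le_integral_of_le_on_Icc hfi (fun v => (Real.exp_pos _).le) fun v hv =>
      Real.exp_le_exp.2 ?_
    have h1 : v ^ (2 * k) ≤ 1 := by
      rw [← (even_two_mul k).pow_abs]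
      exact pow_le_one₀ (abs_nonneg v) hv
    have h2 : c₂ * v ^ (2 * k) ≤ c₂ * 1 := by gcongr
    linarith
  have hZn : 2 * Real.exp (-(Λ + K)) ≤ ∫ v, fn v := by
    refine le_integral_of_le_on_Icc hfni (fun v => (Real.exp_pos _).le) fun v hv =>
      Real.exp_le_exp.2 ?_
    have h1 : v ^ (2 * k) ≤ 1 := by
      rw [← (even_two_mul k).pow_abs]
      exact pow_le_one₀ (abs_nonneg v) hv
    have h2 : c₂ * v ^ (2 * k) ≤ c₂ * 1 := by gcongr
    have h3 := (abs_le.1 (abs_scaled_Hfun_sub_le L h hm0 v)).2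
    have h4 : K * |v| ^ (2 * k + 1) / m ≤ K := by
      refine (div_le_self (by positivity) hm).trans ?_
      exact mul_le_of_le_one_right hK (pow_le_one₀ (abs_nonneg v) hv)
    linarith
  refine ⟨hfni, hfi, hZn, fun z => ?_⟩
  have hUi := (integrable_gaussian_weights hd0 (Real.exp b₁) (2 * k + 1) p).const_mul (K / m)
  have hGi := integrable_gaussian_weights hd0 (Real.exp b₁) 0 p
  have key := abs_cdf_ratio_sub_le (p := p) hfi hfni hUi hGi ?_ ?_ (by positivity) hZ hZn z
  · rw [integral_const_mul] at key
    refine key.trans (le_of_eq ?_)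
    generalize (∫ v : ℝ, |v| ^ (2 * k + 1) * (Real.exp b₁ * Real.exp (-d * v ^ 2)) *
      (1 + |v| ^ p)) = J
    ring
  · intro v
    have h1 : |fn v - f v| ≤ K * |v| ^ (2 * k + 1) / m * g v := by
      refine le_trans ?_ (mul_le_mul_of_nonneg_right (abs_scaled_Hfun_sub_le L h hm0 v)
        (by positivity))
      have := abs_exp_neg_sub_exp_neg_le (hle v) (b := c₂ * v ^ (2 * k)) (by
        rw [← neg_mul]; exact hfg v)
      simpa only [hfn, hf, hg, neg_mul] using this
    calc |fn v - f v| * (1 + |v| ^ p) ≤ K * |v| ^ (2 * k + 1) / m * g v * (1 + |v| ^ p) := by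
          gcongr
      _ = _ := by simp only [hg]; ring
  · intro v
    rw [pow_zero, one_mul, abs_of_pos (Real.exp_pos _)]
    gcongr
    exact hfg v

theorem abs_curieWeiss_sub_linearized_le (L : Measure ℝ) [IsProbabilityMeasure L]
    (hint : ∀ t : ℝ, Integrable (fun x : ℝ => Real.exp (t * x)) L)
    (hone : ∀ t : ℝ, 1 ≤ ∫ x : ℝ, Real.exp (t * x) ∂L) {n : ℕ} (hn : 1 ≤ n) {m : ℝ} (hm : 0 < m)
    (hi : Integrable fun v : ℝ => Real.exp (-((n : ℝ) * Hfun L (v / m))))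
    (hpos : 0 < ∫ v : ℝ, Real.exp (-((n : ℝ) * Hfun L (v / m)))) (z : ℝ) :
    |((curieWeiss L n 1) {x | (∑ i, x i) / ((n : ℝ) / m) ≤ z}).toReal -
        (∫ v in Set.Iic z, Real.exp (-((n : ℝ) * Hfun L (v / m)))) /
          ∫ v : ℝ, Real.exp (-((n : ℝ) * Hfun L (v / m)))| ≤
      Real.exp (-((n : ℝ) * Hfun L (z / m))) * Real.sqrt (2 * Real.pi / ((n : ℝ) / m ^ 2)) /
        ∫ v : ℝ, Real.exp (-((n : ℝ) * Hfun L (v / m))) := by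
  have hn0 : (0 : ℝ) < n := by exact_mod_cast hn
  have key := abs_tilted_sub_le (Measure.pi fun _ : Fin n => L)
    (Y := fun x => (∑ i, x i) / m) (by fun_prop) (a := (n : ℝ) / m ^ 2) (by positivity)
    (fun v => (Real.exp_pos _).le) hi hpos (lintegral_pi_exp_eq L hint hone n hm) _ rfl z
  have hset : {x : Fin n → ℝ | (∑ i, x i) / ((n : ℝ) / m) ≤ z} =
      {x | (∑ i, x i) / m ≤ (n : ℝ) / m ^ 2 * z} := by
    ext x
    simp only [Set.mem_ofPred_eq]
    rw [div_le_iff₀ (by positivity), div_le_iff₀ hm]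
    have : (n : ℝ) / m ^ 2 * z * m = z * ((n : ℝ) / m) := by field_simp
    rw [this]
  have hdens : (fun x : Fin n → ℝ =>
      ENNReal.ofReal (Real.exp (((∑ i, x i) / m) ^ 2 / (2 * ((n : ℝ) / m ^ 2))))) =
      fun x => ENNReal.ofReal (Real.exp (1 * (∑ i, x i) ^ 2 / (2 * n))) := by
    funext x
    congr 2
    field_simp
  rw [hdens] at key
  rw [hset]
  exact key

/-- Non-uniform Berry–Esseen bound for the critical (`β = 1`) general Curie–Weiss
model with `L` of type `k`: `|P(Wₙ ≤ z) − F_k(z)| ≤ C/((1 + 2kc₂|z|^{2k-1}) n^{1/(2k)})`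
with `C` depending only on `b₀, b₁, b₂, k`. -/
theorem stmt4 (k : ℕ) (hk : 1 ≤ k) (b₀ b₁ b₂ : ℝ) (hb₀ : 0 < b₀) (hb₁ : 0 < b₁)
    (hb₂ : 1 < b₂) :
    ∃ C : ℝ, 0 < C ∧
      ∀ (L : Measure ℝ) [IsProbabilityMeasure L] (lamρ : ℝ),
        -- mean `0`, variance `1`
        Integrable (fun x : ℝ => x) L → (∫ x : ℝ, x ∂L) = 0 →
        Integrable (fun x : ℝ => x ^ 2) L → (∫ x : ℝ, x ^ 2 ∂L) = 1 →
        -- `L` is of type `k` with strength `lamρ`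
        (∀ j : ℕ, j ≤ 2 * k → Integrable (fun x : ℝ => x ^ j) L) →
        (∀ j : ℕ, 1 ≤ j → j ≤ 2 * k - 1 → stdNormMoment j - (∫ x : ℝ, x ^ j ∂L) = 0) →
        stdNormMoment (2 * k) - (∫ x : ℝ, x ^ (2 * k) ∂L) = lamρ →
        -- the exponential moment condition (3.4)
        (∀ t : ℝ, Integrable (fun x : ℝ => Real.exp (t * x)) L) →
        (∀ t : ℝ, |t| ≤ b₀ →
          (∫ x : ℝ, Real.exp (t * x) ∂L) ≤ Real.exp (t ^ 2 / 2 - b₁ * t ^ (2 * k))) →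
        (∀ t : ℝ, b₀ < |t| →
          (∫ x : ℝ, Real.exp (t * x) ∂L) ≤ Real.exp (t ^ 2 / (2 * b₂))) →
      ∀ (c₂ : ℝ), c₂ = iteratedDeriv (2 * k) (Hfun L) 0 / (Nat.factorial (2 * k) : ℝ) →
      ∀ (c₁ : ℝ), 0 < c₁ →
        (∫ y : ℝ, c₁ * Real.exp (-c₂ * y ^ (2 * k))) = 1 →
      ∀ n : ℕ, 1 ≤ n →
      ∀ z : ℝ,
        |((curieWeiss L n 1)
            {x | (∑ i, x i) / ((n : ℝ) ^ ((1 : ℝ) - 1 / (2 * (k : ℝ)))) ≤ z}).toReal -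
          (∫ y in Set.Iic z, c₁ * Real.exp (-c₂ * y ^ (2 * k)))| ≤
        C / ((1 + 2 * (k : ℝ) * c₂ * |z| ^ (2 * k - 1)) * (n : ℝ) ^ ((1 : ℝ) / (2 * (k : ℝ)))) := by

  have hc0 : 0 < (1 - 1 / b₂) / 2 := by
    have : 1 / b₂ < 1 := by rw [div_lt_one (by linarith)]; exact hb₂
    linarith
  set d := min b₁ ((1 - 1 / b₂) / 2) with hd_def
  have hd0 : 0 < d := lt_min hb₁ hc0
  have hd1 : d ≤ b₁ := min_le_left _ _
  have hd2 : d ≤ (1 - 1 / b₂) / 2 := min_le_right _ _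
  set p := 2 * k - 1 with hp
  set Λ := momentRatio k with hΛ
  set K := remainderConst k with hK
  have hK0 : 0 < K := remainderConst_pos k
  have hΛ0 : 0 ≤ Λ := momentRatio_nonneg k
  set q := 2 * Real.exp (-(Λ + K)) with hq
  have hq0 : 0 < q := by positivity
  set J := K * ∫ v : ℝ, |v| ^ (2 * k + 1) * (Real.exp b₁ * Real.exp (-d * v ^ 2)) *
    (1 + |v| ^ p) with hJ
  set I := ∫ v : ℝ, |v| ^ 0 * (Real.exp b₁ * Real.exp (-d * v ^ 2)) * (1 + |v| ^ p) with hI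
  have hJ0 : 0 ≤ J := mul_nonneg hK0.le (integral_nonneg fun v => by positivity)
  have hI0 : 0 ≤ I := integral_nonneg fun v => by positivity
  set B := Real.exp b₁ * (2 + (p.factorial : ℝ) / d ^ p) with hB
  have hB0 : 0 < B := by positivity
  refine ⟨(1 + 2 * (k : ℝ) * Λ) *
    (B * Real.sqrt (2 * Real.pi) / q + (J / q + I * J / q ^ 2)), by positivity, ?_⟩
  intro L _ lamρ hL1 hL0 _ hvar _ hmom _ hint h₁ h₂ c₂ hc₂ c₁ hc₁ hnorm n hn z
  obtain ⟨hk2, hbc, hcΛ, hexp⟩ :=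
    Hfun_expansion L hk hb₀ hb₁ hb₂ hL1 hL0 hvar hmom hint h₁ h₂ hc₂
  have hone := one_le_mgf L hL1 hL0 hint
  have hc₂0 : 0 < c₂ := hb₁.trans_le hbc
  have hn1 : (1 : ℝ) ≤ n := by exact_mod_cast hn
  set m := (n : ℝ) ^ ((1 : ℝ) / (2 * (k : ℝ))) with hm
  have hm1 : 1 ≤ m := Real.one_le_rpow hn1 (by positivity)
  have hm0 : 0 < m := by linarith
  have hkR : (k : ℝ) ≠ 0 := by positivity
  have hmn : m ^ (2 * k) = n := by
    rw [hm, ← Real.rpow_natCast, ← Real.rpow_mul (by linarith)]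
    push_cast
    rw [div_mul_cancel₀ _ (by positivity), Real.rpow_one]
  have hscale : (n : ℝ) ^ ((1 : ℝ) - 1 / (2 * (k : ℝ))) = (n : ℝ) / m := by
    rw [Real.rpow_sub (by linarith), Real.rpow_one]
  have hdom := exp_neg_mul_Hfun_le L hk2 hb₁ hd1 hd0 hd2 hone h₁ h₂ hm1
  obtain ⟨hi, -, hZ, hcmp⟩ := abs_linearized_cdf_sub_le L (p := p) hk hd0 hd1 hbc hcΛ hK0.le hexp
    (continuous_Hfun L hint hone) hm1 hdom
  specialize hcmp z
  rw [hmn] at hi hZ hcmp hdom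
  have hcw := abs_curieWeiss_sub_linearized_le L hint hone hn hm0 hi (hq0.trans_le hZ) z
  have hF : (∫ y in Set.Iic z, c₁ * Real.exp (-c₂ * y ^ (2 * k))) =
      (∫ y in Set.Iic z, Real.exp (-c₂ * y ^ (2 * k))) / ∫ y, Real.exp (-c₂ * y ^ (2 * k)) := by
    rw [integral_const_mul] at hnorm ⊢
    rw [eq_div_iff (right_ne_zero_of_mul_eq_one hnorm), mul_right_comm, hnorm, one_mul]
  have hsqrt : Real.sqrt (2 * Real.pi / ((n : ℝ) / m ^ 2)) ≤ Real.sqrt (2 * Real.pi) / m := by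
    rw [← hmn, Real.sqrt_le_left (by positivity), div_pow, Real.sq_sqrt (by positivity)]
    have h4 : m ^ 2 ≤ m ^ (2 * k) / m ^ 2 := by
      rw [le_div_iff₀ (by positivity), ← pow_add]
      exact pow_le_pow_right₀ hm1 (by omega)
    gcongr
  set Zn := ∫ v : ℝ, Real.exp (-((n : ℝ) * Hfun L (v / m)))
  set w := 1 + |z| ^ p with hw
  have hw0 : 0 < w := by positivity
  have hfirst : Real.exp (-((n : ℝ) * Hfun L (z / m))) *
      Real.sqrt (2 * Real.pi / ((n : ℝ) / m ^ 2)) / Zn * w ≤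
      B * Real.sqrt (2 * Real.pi) / q / m := by
    have h5 : Real.exp (-((n : ℝ) * Hfun L (z / m))) * w ≤ B := by
      calc _ ≤ Real.exp b₁ * Real.exp (-d * z ^ 2) * w := by gcongr; exact hdom z
        _ = Real.exp b₁ * (Real.exp (-d * z ^ 2) * w) := by ring
        _ ≤ B := by
          rw [hB]
          gcongr
          exact exp_neg_mul_sq_mul_le hd0 p z
    calc _ = (Real.exp (-((n : ℝ) * Hfun L (z / m))) * w) *
          Real.sqrt (2 * Real.pi / ((n : ℝ) / m ^ 2)) / Zn := by ring
      _ ≤ B * (Real.sqrt (2 * Real.pi) / m) / q := by gcongr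
      _ = _ := by ring
  rw [hscale, hF]
  set P := ((curieWeiss L n 1) {x | (∑ i, x i) / ((n : ℝ) / m) ≤ z}).toReal
  have htotal : ∀ a b : ℝ, |P - b| ≤ |P - a| + |a - b| := fun a b => abs_sub_le _ _ _
  have hsum := htotal ((∫ v in Set.Iic z, Real.exp (-((n : ℝ) * Hfun L (v / m)))) / Zn)
    ((∫ y in Set.Iic z, Real.exp (-c₂ * y ^ (2 * k))) / ∫ y, Real.exp (-c₂ * y ^ (2 * k)))
  have hweight : 1 + 2 * (k : ℝ) * c₂ * |z| ^ p ≤ (1 + 2 * (k : ℝ) * Λ) * w := by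
    have h6 : 2 * (k : ℝ) * c₂ * |z| ^ p ≤ 2 * (k : ℝ) * Λ * |z| ^ p := by gcongr
    have h7 : 0 ≤ 2 * (k : ℝ) * Λ := by positivity
    have h8 : 0 ≤ |z| ^ p := by positivity
    rw [hw]
    nlinarith
  rw [le_div_iff₀ (by positivity)]
  set Δ := |P - (∫ y in Set.Iic z, Real.exp (-c₂ * y ^ (2 * k))) /
    ∫ y, Real.exp (-c₂ * y ^ (2 * k))|
  have hΔ : Δ * w ≤ (B * Real.sqrt (2 * Real.pi) / q + (J / q + I * J / q ^ 2)) / m := by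
    rw [add_div]
    calc Δ * w ≤ _ * w := mul_le_mul_of_nonneg_right hsum hw0.le
      _ = _ * w + _ * w := add_mul _ _ _
      _ ≤ _ := add_le_add ((mul_le_mul_of_nonneg_right hcw hw0.le).trans hfirst) hcmp
  rw [le_div_iff₀ hm0] at hΔ
  calc Δ * ((1 + 2 * (k : ℝ) * c₂ * |z| ^ p) * m)
      ≤ Δ * (((1 + 2 * (k : ℝ) * Λ) * w) * m) := by gcongr
    _ = (1 + 2 * (k : ℝ) * Λ) * (Δ * w * m) := by ring
    _ ≤ _ := by gcongr
end

section
/- Let g : ℝ → ℝ be continuous, non-decreasing, with x·g(x) ≥ 0 for all x, let G(x) = ∫₀ˣ g(t)dt, p(x) = c₁e^{−G(x)} with c₁ the constant making ∫_ℝ p = 1, and let F(z) = ∫_{−∞}^z p(y)dy. Then for every z > 0 with g(z) > 0: 1 − F(z) ≤ p(z)/g(z). -/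
open MeasureTheory intervalIntegral

/-- The primitive of a continuous non-decreasing function lies above its tangent lines. -/
theorem Monotone.add_mul_le_intervalIntegral {g : ℝ → ℝ} (hgc : Continuous g) (hgm : Monotone g)
    {a z x : ℝ} (hzx : z ≤ x) :
    (∫ t in a..z, g t) + g z * (x - z) ≤ ∫ t in a..x, g t := by
  rw [← integral_add_adjacent_intervals (hgc.intervalIntegrable a z)
    (hgc.intervalIntegrable z x)]
  have h : ∫ _ in z..x, g z ≤ ∫ t in z..x, g t :=
    integral_mono_on hzx (continuous_const.intervalIntegrable z x)
      (hgc.intervalIntegrable z x) fun t ht => hgm ht.1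
  rw [intervalIntegral.integral_const, smul_eq_mul] at h
  linarith

/-- Tail bound for a function dominated on `(z, ∞)` by an exponential of rate `a`. -/
theorem setIntegral_Ioi_le_div_of_le_exp {p : ℝ → ℝ} {z a C : ℝ} (ha : 0 < a)
    (hint : IntegrableOn p (Set.Ioi z))
    (hle : ∀ x ∈ Set.Ioi z, p x ≤ C * Real.exp (-a * (x - z))) :
    ∫ x in Set.Ioi z, p x ≤ C / a := by
  have hexp : ∀ x, C * Real.exp (-a * (x - z)) = C * Real.exp (a * z) * Real.exp (-a * x) := by
    intro x
    rw [mul_assoc, ← Real.exp_add]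
    ring_nf
  simp only [hexp] at hle
  refine (setIntegral_mono_on hint ((integrableOn_exp_mul_Ioi (neg_lt_zero.2 ha) z).const_mul _)
    measurableSet_Ioi hle).trans_eq ?_
  rw [MeasureTheory.integral_const_mul, integral_exp_mul_Ioi (neg_lt_zero.2 ha), neg_div_neg_eq,
    mul_div_assoc', mul_assoc, ← Real.exp_add]
  simp

/-- Tail bound `1 - F(z) ≤ p(z)/g(z)` for `z > 0` with `g(z) > 0`, where
`p(x) = c₁ e^{-G(x)}`, `G(x) = ∫₀ˣ g`, and `F` is the distribution function of `p`. -/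
theorem stmt11 (g : ℝ → ℝ) (hgc : Continuous g) (hgm : Monotone g)
    (hsign : ∀ x : ℝ, 0 ≤ x * g x) (c₁ : ℝ) (hc₁ : 0 < c₁)
    (p : ℝ → ℝ) (hp : ∀ x : ℝ, p x = c₁ * Real.exp (-∫ t in (0:ℝ)..x, g t))
    (hnorm : ∫ x : ℝ, p x = 1)
    (F : ℝ → ℝ) (hF : ∀ z : ℝ, F z = ∫ x in Set.Iic z, p x) :
    ∀ z : ℝ, 0 < z → 0 < g z → 1 - F z ≤ p z / g z := by
  intro z _ hgz
  have hint : Integrable p := .of_integral_ne_zero (by simp [hnorm])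
  rw [hF, ← hnorm, ← integral_Iic_add_Ioi (b := z) hint.integrableOn hint.integrableOn,
    add_sub_cancel_left]
  refine setIntegral_Ioi_le_div_of_le_exp hgz hint.integrableOn fun x hx => ?_
  rw [hp, hp, mul_assoc, ← Real.exp_add]
  gcongr
  linarith [hgm.add_mul_le_intervalIntegral hgc (a := 0) (le_of_lt hx)]
end

section
/- Let g : ℝ → ℝ be continuous, non-decreasing, with x·g(x) ≥ 0 for all x, let G(x) = ∫₀ˣ g(t)dt, p(x) = c₁e^{−G(x)} with c₁ the constant making ∫_ℝ p = 1, and let F(z) = ∫_{−∞}^z p(y)dy. Then for every z < 0 with g(z) < 0: F(z) ≤ p(z)/|g(z)|. -/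
open MeasureTheory intervalIntegral

/-- A continuous monotone function integrates over `[x, z]` to at most `(z - x) * g z`. -/
lemma integral_le_sub_mul_right_of_monotone {g : ℝ → ℝ} (hgc : Continuous g) (hgm : Monotone g)
    {x z : ℝ} (hxz : x ≤ z) : ∫ t in x..z, g t ≤ (z - x) * g z := by
  calc ∫ t in x..z, g t ≤ ∫ _ in x..z, g z :=
        integral_mono_on hxz (hgc.intervalIntegrable _ _) intervalIntegrable_const
          fun t ht => hgm ht.2
    _ = (z - x) * g z := by simp

/-- Tail bound `F(z) ≤ p(z)/|g(z)|` for `z < 0` with `g(z) < 0`, where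
`p(x) = c₁ e^{-G(x)}`, `G(x) = ∫₀ˣ g`, and `F` is the distribution function of `p`. -/
theorem stmt12 (g : ℝ → ℝ) (hgc : Continuous g) (hgm : Monotone g)
    (hsign : ∀ x : ℝ, 0 ≤ x * g x) (c₁ : ℝ) (hc₁ : 0 < c₁)
    (p : ℝ → ℝ) (hp : ∀ x : ℝ, p x = c₁ * Real.exp (-∫ t in (0:ℝ)..x, g t))
    (hnorm : ∫ x : ℝ, p x = 1)
    (F : ℝ → ℝ) (hF : ∀ z : ℝ, F z = ∫ x in Set.Iic z, p x) :
    ∀ z : ℝ, z < 0 → g z < 0 → F z ≤ p z / |g z| := by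
  intro z _ hgz
  have ha : 0 < -g z := neg_pos.2 hgz
  have hbound : ∀ x ∈ Set.Iic z, p x ≤ p z * Real.exp (g z * z) * Real.exp (-g z * x) := by
    intro x hx
    have hsplit := integral_add_adjacent_intervals (hgc.intervalIntegrable (μ := volume) 0 x)
      (hgc.intervalIntegrable x z)
    have hle := integral_le_sub_mul_right_of_monotone hgc hgm hx
    rw [hp, hp, mul_assoc, mul_assoc, ← Real.exp_add, ← Real.exp_add]
    gcongr
    linarith
  have hpint : Integrable p := .of_integral_ne_zero (by simp [hnorm])
  rw [hF, abs_of_neg hgz]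
  calc ∫ x in Set.Iic z, p x
      ≤ ∫ x in Set.Iic z, p z * Real.exp (g z * z) * Real.exp (-g z * x) :=
        setIntegral_mono_on hpint.integrableOn
          ((integrableOn_exp_mul_Iic ha z).const_mul _) measurableSet_Iic hbound
    _ = p z / -g z := by
        rw [MeasureTheory.integral_const_mul, integral_exp_mul_Iic ha, ← mul_div_assoc, mul_assoc,
          ← Real.exp_add]
        simp
end
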